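/- arXiv:1310.7178 — 8 statements merged into one kernel-verified Lean document; each statement's English description precedes it below -/
import Mathlib

section
/- Let ρ and σ be d×d positive definite complex matrices with σ ≤ ρ, let α > 1 and z ≥ α − 1. Then f_{α,z}(ρ||σ) ≥ Tr ρ, i.e. Tr((ρ^{α/(2z)} σ^{(1−α)/z} ρ^{α/(2z)})^z) ≥ Tr ρ; equivalently, D_{α,z}(ρ||σ) ≥ 0 whenever ρ ≥ σ (Order Axiom, case α > 1). -/
open Matrix Filter
open scoped ComplexOrder

/-- Real power of a matrix, defined via the Hermitian functional calculus
(with the convention `(0:ℝ) ^ t = 0` for `t ≠ 0` from `Real.rpow`);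
junk value `0` for non-Hermitian matrices. -/
noncomputable def mpow {n : Type*} [Fintype n] [DecidableEq n]
    (A : Matrix n n ℂ) (t : ℝ) : Matrix n n ℂ :=
  if hA : A.IsHermitian then hA.cfc (fun x => x ^ t) else 0

/-- The α-z trace functional `f_{α,z}(ρ‖σ) = Tr((ρ^{α/2z} σ^{(1-α)/z} ρ^{α/2z})^z)`. -/
noncomputable def traceFun {n : Type*} [Fintype n] [DecidableEq n]
    (α z : ℝ) (ρ σ : Matrix n n ℂ) : ℂ :=
  Matrix.trace (mpow (mpow ρ (α / (2 * z)) * mpow σ ((1 - α) / z) * mpow ρ (α / (2 * z))) z)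

/-- The α-z relative Rényi entropy `D_{α,z}(ρ‖σ) = (α-1)⁻¹ log₂ (f_{α,z}(ρ‖σ)/Tr ρ)`. -/
noncomputable def Dent {n : Type*} [Fintype n] [DecidableEq n]
    (α z : ℝ) (ρ σ : Matrix n n ℂ) : ℝ :=
  (α - 1)⁻¹ * Real.logb 2 ((traceFun α z ρ σ).re / (Matrix.trace ρ).re)

section Helpers

open scoped MatrixOrder Matrix.Norms.L2Operator

theorem aux_trace_cfc {n : Type*} [Fintype n] [DecidableEq n] {A : Matrix n n ℂ}
    (hA : A.IsHermitian) (f : ℝ → ℝ) :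
    (Matrix.trace (hA.cfc f)).re = ∑ i, f (hA.eigenvalues i) := by
  rw [Matrix.IsHermitian.cfc, Unitary.conjStarAlgAut_apply, Matrix.trace_mul_comm, ← mul_assoc]
  simp [Matrix.trace]

theorem aux_diag {n : Type*} [Fintype n] [DecidableEq n] (W : Matrix n n ℂ) (b : n → ℝ) (i : n) :
    (W * diagonal (fun j => (b j : ℂ)) * star W) i i
      = ((∑ j, Complex.normSq (W i j) * b j : ℝ) : ℂ) := by
  rw [Matrix.mul_apply]
  push_cast
  refine Finset.sum_congr rfl fun j _ => ?_
  rw [Matrix.mul_diagonal, Matrix.star_apply, Complex.normSq_eq_conj_mul_self]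
  simp only [RCLike.star_def]
  ring

theorem aux_row {n : Type*} [Fintype n] [DecidableEq n] (W : Matrix n n ℂ) (h : W * star W = 1)
    (i : n) : ∑ j, Complex.normSq (W i j) = 1 := by
  have h1 := aux_diag W (fun _ => 1) i
  simp only [Complex.ofReal_one, Matrix.diagonal_one, mul_one, h, Matrix.one_apply_eq] at h1
  exact_mod_cast h1.symm

theorem aux_col {n : Type*} [Fintype n] [DecidableEq n] (W : Matrix n n ℂ) (h : star W * W = 1)
    (j : n) : ∑ i, Complex.normSq (W i j) = 1 := by
  have := aux_row (star W) (by simpa using h) j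
  simpa [Matrix.star_apply] using this

theorem aux_convex {n : Type*} [Fintype n] [DecidableEq n] {A B : Matrix n n ℂ}
    (hA : A.PosSemidef) (hB : B.PosSemidef) (h : (B - A).PosSemidef) (z : ℝ) (hz : 1 ≤ z) :
    (Matrix.trace (mpow A z)).re ≤ (Matrix.trace (mpow B z)).re := by
  rw [mpow, mpow, dif_pos hA.1, dif_pos hB.1, aux_trace_cfc, aux_trace_cfc]
  set U : Matrix n n ℂ := (hA.1.eigenvectorUnitary : Matrix n n ℂ) with hU
  set V : Matrix n n ℂ := (hB.1.eigenvectorUnitary : Matrix n n ℂ) with hV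
  have hU1 : star U * U = 1 := by simp [hU]
  have hU2 : U * star U = 1 := by simp [hU]
  have hV1 : star V * V = 1 := by simp [hV]
  have hV2 : V * star V = 1 := by simp [hV]
  set a := hA.1.eigenvalues
  set b := hB.1.eigenvalues
  have hAs : A = U * diagonal (fun j => (a j : ℂ)) * star U := by
    have := hA.1.spectral_theorem
    rw [Unitary.conjStarAlgAut_apply] at this
    exact this
  have hBs : B = V * diagonal (fun j => (b j : ℂ)) * star V := by
    have := hB.1.spectral_theorem
    rw [Unitary.conjStarAlgAut_apply] at this
    exact this
  set W := star U * V with hW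
  have hW1 : W * star W = 1 := by
    rw [hW, star_mul, star_star, mul_assoc, ← mul_assoc V, hV2, one_mul, hU1]
  have hW2 : star W * W = 1 := by
    rw [hW, star_mul, star_star, mul_assoc, ← mul_assoc U, hU2, one_mul, hV1]
  have hle : ∀ i, a i ≤ ∑ j, Complex.normSq (W i j) * b j := by
    intro i
    have h1 := (h.conjTranspose_mul_mul_same U).diag_nonneg (i := i)
    have e1 : Uᴴ * B * U = W * diagonal (fun j => (b j : ℂ)) * star W := by
      rw [hW, star_mul, star_star, hBs]
      simp only [mul_assoc, Matrix.star_eq_conjTranspose]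
    have e2 : Uᴴ * A * U = diagonal (fun j => (a j : ℂ)) := by
      rw [hAs, ← Matrix.star_eq_conjTranspose]
      calc _ = (star U * U) * diagonal (fun j => (a j : ℂ)) * (star U * U) := by
            simp only [mul_assoc]
        _ = _ := by rw [hU1]; simp
    rw [mul_sub, sub_mul, e1, e2, Matrix.sub_apply, aux_diag, Matrix.diagonal_apply_eq] at h1
    rw [← Complex.ofReal_sub, Complex.zero_le_real] at h1
    linarith
  have ha0 : ∀ i, 0 ≤ a i := hA.eigenvalues_nonneg
  have hb0 : ∀ i, 0 ≤ b i := hB.eigenvalues_nonneg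
  calc ∑ i, a i ^ z ≤ ∑ i, (∑ j, Complex.normSq (W i j) * b j) ^ z :=
        Finset.sum_le_sum fun i _ => Real.rpow_le_rpow (ha0 i) (hle i) (by linarith)
    _ ≤ ∑ i, ∑ j, Complex.normSq (W i j) * b j ^ z :=
        Finset.sum_le_sum fun i _ => Real.rpow_arith_mean_le_arith_mean_rpow _ _ _
          (fun j _ => Complex.normSq_nonneg _) (aux_row W hW1 i) (fun j _ => hb0 j) hz
    _ = ∑ j, b j ^ z := by
        rw [Finset.sum_comm]
        refine Finset.sum_congr rfl fun j _ => ?_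
        rw [← Finset.sum_mul, aux_col W hW2, one_mul]

theorem aux_mpow {n : Type*} [Fintype n] [DecidableEq n] {A : Matrix n n ℂ}
    (hA : A.PosSemidef) (t : ℝ) : mpow A t = A ^ t := by
  rw [mpow, dif_pos hA.1, CFC.rpow_eq_cfc_real (Matrix.nonneg_iff_posSemidef.2 hA), hA.1.cfc_eq]

theorem aux_mono {n : Type*} [Fintype n] [DecidableEq n] {A B : Matrix n n ℂ}
    (hA : A.PosSemidef) (hB : B.PosSemidef) (h : (B - A).PosSemidef) (z : ℝ) (hz : 0 < z) :
    (Matrix.trace (mpow A z)).re ≤ (Matrix.trace (mpow B z)).re := by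
  rcases le_total 1 z with h1 | h1
  · exact aux_convex hA hB h z h1
  · rw [aux_mpow hA, aux_mpow hB]
    have := CFC.rpow_le_rpow (p := z) ⟨hz.le, h1⟩ (Matrix.le_iff.2 h)
    have := (Matrix.le_iff.1 this).trace_nonneg
    rw [Matrix.trace_sub] at this
    have := (Complex.le_def.1 this).1
    simpa using this

theorem aux_main {d : ℕ} (ρ σ : Matrix (Fin d) (Fin d) ℂ)
    (hρ : ρ.PosDef) (hσ : σ.PosDef) (hle : (ρ - σ).PosSemidef)
    (α z : ℝ) (hα : 1 < α) (hz : α - 1 ≤ z) :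
    (Matrix.trace ρ).re ≤ (traceFun α z ρ σ).re := by
  have hz0 : 0 < z := by linarith
  have sρ : IsStrictlyPositive ρ := Matrix.isStrictlyPositive_iff_posDef.2 hρ
  have sσ : IsStrictlyPositive σ := Matrix.isStrictlyPositive_iff_posDef.2 hσ
  set s := (α - 1) / z with hs
  have hs0 : 0 < s := div_pos (by linarith) hz0
  have hs1 : s ≤ 1 := (div_le_one hz0).2 hz
  have hes : (1 - α) / z = s * (-1) := by rw [hs]; ring
  have h1 : σ ^ s ≤ ρ ^ s := CFC.rpow_le_rpow ⟨hs0.le, hs1⟩ (Matrix.le_iff.2 hle)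
  have h2 : ρ ^ (s * (-1)) ≤ σ ^ (s * (-1)) := by
    rw [← CFC.rpow_rpow ρ s (-1) hs0.ne' sρ, ← CFC.rpow_rpow σ s (-1) hs0.ne' sσ]
    exact CStarAlgebra.rpow_neg_one_le_rpow_neg_one h1 (sσ.rpow σ s)
  have h3 : ρ ^ (α / (2 * z)) * ρ ^ (s * (-1)) * ρ ^ (α / (2 * z)) = ρ ^ (1 / z) := by
    rw [← CFC.rpow_add sρ.isUnit, ← CFC.rpow_add sρ.isUnit]
    congr 1
    rw [hs]; field_simp; ring
  have hsa : (ρ ^ (α / (2 * z)))ᴴ = ρ ^ (α / (2 * z)) :=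
    (Matrix.nonneg_iff_posSemidef.1 CFC.rpow_nonneg).1
  have hX : (ρ ^ (α / (2 * z)) * σ ^ (s * (-1)) * ρ ^ (α / (2 * z))).PosSemidef := by
    have := (Matrix.nonneg_iff_posSemidef.1
      (CFC.rpow_nonneg (a := σ) (y := s * (-1)))).conjTranspose_mul_mul_same (ρ ^ (α / (2 * z)))
    rwa [hsa] at this
  have h4 : (ρ ^ (α / (2 * z)) * σ ^ (s * (-1)) * ρ ^ (α / (2 * z)) - ρ ^ (1 / z)).PosSemidef := by
    have := (Matrix.le_iff.1 h2).conjTranspose_mul_mul_same (ρ ^ (α / (2 * z)))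
    rwa [hsa, mul_sub, sub_mul, h3] at this
  have hY : (ρ ^ (1 / z)).PosSemidef := Matrix.nonneg_iff_posSemidef.1 CFC.rpow_nonneg
  have h5 := aux_mono hY hX h4 z hz0
  rw [aux_mpow hY, CFC.rpow_rpow ρ (1 / z) z (by positivity) sρ, one_div,
    inv_mul_cancel₀ hz0.ne', CFC.rpow_one ρ sρ.nonneg] at h5
  rw [traceFun, hes, aux_mpow hρ.posSemidef, aux_mpow hσ.posSemidef]
  exact h5

end Helpers

/-- Order Axiom, case α > 1: if σ ≤ ρ (Loewner order), α > 1 and z ≥ α - 1, then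
`f_{α,z}(ρ‖σ) ≥ Tr ρ`, equivalently `D_{α,z}(ρ‖σ) ≥ 0`. -/
theorem order_axiom_alpha_gt_one {d : ℕ} (ρ σ : Matrix (Fin d) (Fin d) ℂ)
    (hρ : ρ.PosDef) (hσ : σ.PosDef) (hle : (ρ - σ).PosSemidef)
    (α z : ℝ) (hα : 1 < α) (hz : α - 1 ≤ z) :
    (Matrix.trace ρ).re ≤ (traceFun α z ρ σ).re ∧ 0 ≤ Dent α z ρ σ := by
  have h := aux_main ρ σ hρ hσ hle α z hα hz
  refine ⟨h, ?_⟩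
  have h0 : 0 ≤ (Matrix.trace ρ).re := (Complex.le_def.1 hρ.posSemidef.trace_nonneg).1
  unfold Dent
  refine mul_nonneg (inv_nonneg.2 (by linarith)) ?_
  rcases h0.eq_or_lt with h0 | h0
  · rw [← h0]; simp
  · exact Real.logb_nonneg (by norm_num) ((one_le_div h0).2 h)
end

section
/- Let ρ, σ be positive definite d×d complex matrices and τ, ω be positive definite d'×d' complex matrices, and let 0 < α < 1 and z > 0. Then the trace functional is multiplicative with respect to tensor (Kronecker) products: f_{α,z}(ρ ⊗ τ || σ ⊗ ω) = f_{α,z}(ρ||σ) · f_{α,z}(τ||ω); consequently D_{α,z}(ρ ⊗ τ || σ ⊗ ω) = D_{α,z}(ρ||σ) + D_{α,z}(τ||ω) when ρ and τ have unit trace (Additivity Axiom). -/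
open Matrix Filter
open scoped ComplexOrder

open scoped Kronecker

/-- The Hermitian functional calculus can be computed from any unitary diagonalization. -/
lemma cfc_of_diag {n : Type*} [Fintype n] [DecidableEq n] {A : Matrix n n ℂ}
    (hA : A.IsHermitian) (U : Matrix n n ℂ) (hU : U ∈ unitary (Matrix n n ℂ)) (e : n → ℝ)
    (hUe : A = U * diagonal (fun i => (e i : ℂ)) * star U) (f : ℝ → ℝ) :
    hA.cfc f = U * diagonal (fun i => (f (e i) : ℂ)) * star U := by
  obtain ⟨V, hV⟩ : ∃ V : Matrix n n ℂ, V = hA.eigenvectorUnitary := ⟨_, rfl⟩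
  have hV1 : V ∈ unitary (Matrix n n ℂ) := hV ▸ hA.eigenvectorUnitary.2
  have hVA : A = V * diagonal (fun i => (hA.eigenvalues i : ℂ)) * star V := by
    rw [hV]; exact hA.spectral_theorem
  have hcfc : hA.cfc f = V * diagonal (fun i => (f (hA.eigenvalues i) : ℂ)) * star V := by
    rw [hV]; rfl
  obtain ⟨hU1, hU2⟩ := Unitary.mem_iff.1 hU
  obtain ⟨hV1, hV2⟩ := Unitary.mem_iff.1 hV1
  have key : (star U * V) * diagonal (fun i => (hA.eigenvalues i : ℂ))
      = diagonal (fun i => (e i : ℂ)) * (star U * V) := by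
    have h1 : star U * A * V = (star U * V) * diagonal (fun i => (hA.eigenvalues i : ℂ)) := by
      calc star U * A * V
          = star U * (V * diagonal (fun i => (hA.eigenvalues i : ℂ)) * star V) * V := by rw [← hVA]
        _ = (star U * V) * diagonal (fun i => (hA.eigenvalues i : ℂ)) * (star V * V) := by
            simp only [mul_assoc]
        _ = _ := by rw [hV1, mul_one]
    have h2 : star U * A * V = diagonal (fun i => (e i : ℂ)) * (star U * V) := by
      calc star U * A * V
          = star U * (U * diagonal (fun i => (e i : ℂ)) * star U) * V := by rw [← hUe]
        _ = (star U * U) * (diagonal (fun i => (e i : ℂ)) * (star U * V)) := by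
            simp only [mul_assoc]
        _ = _ := by rw [hU1, one_mul]
    rw [← h1, h2]
  have key2 : (star U * V) * diagonal (fun i => (f (hA.eigenvalues i) : ℂ))
      = diagonal (fun i => (f (e i) : ℂ)) * (star U * V) := by
    ext i j
    have := congrFun (congrFun key i) j
    rw [mul_diagonal, diagonal_mul] at this ⊢
    by_cases h0 : (star U * V) i j = 0
    · simp [h0]
    · rw [mul_comm] at this
      have h3 := mul_right_cancel₀ h0 this
      have h4 : hA.eigenvalues j = e i := by exact_mod_cast h3
      rw [h4, mul_comm]
  calc hA.cfc f = (U * star U) * (V * diagonal (fun i => (f (hA.eigenvalues i) : ℂ)) * star V) := by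
        rw [hU2, one_mul, hcfc]
    _ = U * ((star U * V) * diagonal (fun i => (f (hA.eigenvalues i) : ℂ))) * star V := by
        simp only [mul_assoc]
    _ = U * diagonal (fun i => (f (e i) : ℂ)) * star U * (V * star V) := by
        rw [key2]; simp only [mul_assoc]
    _ = _ := by rw [hV2, mul_one]

lemma mpow_eq {n : Type*} [Fintype n] [DecidableEq n] {A : Matrix n n ℂ}
    (hA : A.IsHermitian) (t : ℝ) :
    mpow A t = (hA.eigenvectorUnitary : Matrix n n ℂ) *
      diagonal (fun i => ((hA.eigenvalues i ^ t : ℝ) : ℂ)) *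
      star (hA.eigenvectorUnitary : Matrix n n ℂ) := by
  rw [mpow, dif_pos hA]; rfl

lemma mpow_posDef {n : Type*} [Fintype n] [DecidableEq n] {A : Matrix n n ℂ}
    (hA : A.PosDef) (t : ℝ) : (mpow A t).PosDef := by
  rw [mpow_eq hA.1, Unitary.isUnit_coe.posDef_star_right_conjugate_iff, posDef_diagonal_iff]
  intro i
  exact_mod_cast Real.rpow_pos_of_pos (hA.eigenvalues_pos i) t

lemma mpow_kronecker {m n : Type*} [Fintype m] [DecidableEq m] [Fintype n] [DecidableEq n]
    {A : Matrix m m ℂ} {B : Matrix n n ℂ} (hA : A.PosDef) (hB : B.PosDef) (t : ℝ) :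
    mpow (A ⊗ₖ B) t = mpow A t ⊗ₖ mpow B t := by
  have hAB := (hA.kronecker hB).1
  have hs : A ⊗ₖ B = ((hA.1.eigenvectorUnitary : Matrix m m ℂ) ⊗ₖ
      (hB.1.eigenvectorUnitary : Matrix n n ℂ)) *
      diagonal (fun p : m × n => ((hA.1.eigenvalues p.1 * hB.1.eigenvalues p.2 : ℝ) : ℂ)) *
      star ((hA.1.eigenvectorUnitary : Matrix m m ℂ) ⊗ₖ
      (hB.1.eigenvectorUnitary : Matrix n n ℂ)) := by
    conv_lhs => rw [hA.1.spectral_theorem, hB.1.spectral_theorem]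
    rw [Unitary.conjStarAlgAut_apply, Unitary.conjStarAlgAut_apply, mul_kronecker_mul,
      mul_kronecker_mul, diagonal_kronecker_diagonal, star_eq_conjTranspose, star_eq_conjTranspose,
      star_eq_conjTranspose, conjTranspose_kronecker]
    simp
  rw [mpow, dif_pos hAB, cfc_of_diag hAB _ (kronecker_mem_unitary hA.1.eigenvectorUnitary.2
    hB.1.eigenvectorUnitary.2) _ hs, mpow_eq hA.1, mpow_eq hB.1, mul_kronecker_mul,
    mul_kronecker_mul, diagonal_kronecker_diagonal, star_eq_conjTranspose, star_eq_conjTranspose,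
      star_eq_conjTranspose, conjTranspose_kronecker]
  congr 3
  funext p
  rw [Real.mul_rpow (hA.eigenvalues_pos _).le (hB.eigenvalues_pos _).le, Complex.ofReal_mul]

lemma inner_posDef {n : Type*} [Fintype n] [DecidableEq n] {A B : Matrix n n ℂ}
    (hA : A.PosDef) (hB : B.PosDef) (s t : ℝ) : (mpow A s * mpow B t * mpow A s).PosDef := by
  have h := mpow_posDef hA s
  have h2 := (h.isUnit.posDef_star_right_conjugate_iff (x := mpow B t)).2 (mpow_posDef hB t)
  rwa [star_eq_conjTranspose, h.1.eq] at h2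

lemma traceFun_pos {n : Type*} [Fintype n] [DecidableEq n] [Nonempty n] {A B : Matrix n n ℂ}
    (hA : A.PosDef) (hB : B.PosDef) (α z : ℝ) : 0 < traceFun α z A B :=
  (mpow_posDef (inner_posDef hA hB _ _) z).trace_pos

lemma nonempty_of_trace {n : Type*} [Fintype n] {A : Matrix n n ℂ}
    (h : Matrix.trace A = 1) : Nonempty n := by
  by_contra hn
  rw [not_nonempty_iff] at hn
  simp [Matrix.trace] at h

/-- Multiplicativity of the trace functional with respect to tensor (Kronecker) products:
`f_{α,z}(ρ ⊗ τ ‖ σ ⊗ ω) = f_{α,z}(ρ‖σ) · f_{α,z}(τ‖ω)`, and consequently additivity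
`D_{α,z}(ρ ⊗ τ ‖ σ ⊗ ω) = D_{α,z}(ρ‖σ) + D_{α,z}(τ‖ω)` when `Tr ρ = Tr τ = 1`. -/
theorem traceFun_kronecker {d d' : ℕ}
    (ρ σ : Matrix (Fin d) (Fin d) ℂ) (τ ω : Matrix (Fin d') (Fin d') ℂ)
    (hρ : ρ.PosDef) (hσ : σ.PosDef) (hτ : τ.PosDef) (hω : ω.PosDef)
    (α z : ℝ) (hα0 : 0 < α) (hα1 : α < 1) (hz : 0 < z) :
    traceFun α z (ρ ⊗ₖ τ) (σ ⊗ₖ ω) = traceFun α z ρ σ * traceFun α z τ ω ∧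
      (Matrix.trace ρ = 1 → Matrix.trace τ = 1 →
        Dent α z (ρ ⊗ₖ τ) (σ ⊗ₖ ω) = Dent α z ρ σ + Dent α z τ ω) := by
  have hmul : traceFun α z (ρ ⊗ₖ τ) (σ ⊗ₖ ω) = traceFun α z ρ σ * traceFun α z τ ω := by
    simp only [traceFun]
    rw [mpow_kronecker hρ hτ, mpow_kronecker hσ hω, ← mul_kronecker_mul, ← mul_kronecker_mul,
      mpow_kronecker (inner_posDef hρ hσ _ _) (inner_posDef hτ hω _ _), trace_kronecker]
  refine ⟨hmul, fun h1 h2 => ?_⟩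
  have := nonempty_of_trace h1
  have := nonempty_of_trace h2
  obtain ⟨p1, q1⟩ := Complex.pos_iff.1 (traceFun_pos hρ hσ α z)
  obtain ⟨p2, q2⟩ := Complex.pos_iff.1 (traceFun_pos hτ hω α z)
  simp only [Dent]
  rw [hmul, trace_kronecker, h1, h2, Complex.mul_re, ← q1]
  simp only [zero_mul, sub_zero, mul_one, Complex.one_re, div_one]
  rw [Real.logb_mul p1.ne' p2.ne', mul_add]
end

section
/- Let 0 < p ≤ 1 and 0 < q ≤ 1, and let K be a fixed d×d complex matrix. Then the trace functional A ↦ f_{p,q}(A;K) := Tr((A^{p/2} K A^q K* A^{p/2})^{1/(p+q)}) is concave on the set of positive definite d×d complex matrices: for all positive definite A₁, A₂ and all t ∈ [0,1], f_{p,q}(tA₁ + (1−t)A₂; K) ≥ t·f_{p,q}(A₁;K) + (1−t)·f_{p,q}(A₂;K). -/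
open Matrix Filter
open scoped ComplexOrder

/-- The trace functional `f_{p,q}(A;K) = Tr((A^{p/2} K A^q K* A^{p/2})^{1/(p+q)})`. -/
noncomputable def fpq {n : Type*} [Fintype n] [DecidableEq n]
    (p q : ℝ) (K A : Matrix n n ℂ) : ℝ :=
  (Matrix.trace (mpow (mpow A (p / 2) * K * mpow A q * Kᴴ * mpow A (p / 2))
    (1 / (p + q)))).re


namespace FPQ
set_option linter.unusedSectionVars false
section
variable {n : Type*} [Fintype n] [DecidableEq n]

/-- Complex power of a real number, with `0 ^ z = 0` for all `z`. -/
noncomputable def gp (l : ℝ) (z : ℂ) : ℂ := if l = 0 then 0 else Complex.exp (z * (Real.log l : ℝ))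

lemma gp_add (l : ℝ) (z w : ℂ) : gp l (z + w) = gp l z * gp l w := by
  unfold gp
  split_ifs
  · simp
  · rw [← Complex.exp_add]; ring_nf

lemma gp_conj (l : ℝ) (z : ℂ) : star (gp l z) = gp l (star z) := by
  unfold gp
  split_ifs
  · simp
  · simp [← Complex.exp_conj]

lemma gp_real {l : ℝ} (hl : 0 ≤ l) {x : ℝ} (hx : x ≠ 0) : gp l (x : ℂ) = ((l ^ x : ℝ) : ℂ) := by
  unfold gp
  split_ifs with h
  · simp [h, Real.zero_rpow hx]
  · rw [Real.rpow_def_of_pos (lt_of_le_of_ne hl (Ne.symm h))]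
    push_cast; ring_nf

/-- Complex powers of a Hermitian matrix. -/
noncomputable def cp {A : Matrix n n ℂ} (hA : A.IsHermitian) (z : ℂ) : Matrix n n ℂ :=
  (hA.eigenvectorUnitary : Matrix n n ℂ) * diagonal (fun i => gp (hA.eigenvalues i) z) *
    (hA.eigenvectorUnitary : Matrix n n ℂ)ᴴ

lemma eig_mul {A : Matrix n n ℂ} (hA : A.IsHermitian) :
    (hA.eigenvectorUnitary : Matrix n n ℂ)ᴴ * (hA.eigenvectorUnitary : Matrix n n ℂ) = 1 :=
  Unitary.coe_star_mul_self hA.eigenvectorUnitary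

lemma eig_mul' {A : Matrix n n ℂ} (hA : A.IsHermitian) :
    (hA.eigenvectorUnitary : Matrix n n ℂ) * (hA.eigenvectorUnitary : Matrix n n ℂ)ᴴ = 1 :=
  Unitary.coe_mul_star_self hA.eigenvectorUnitary

lemma cp_add {A : Matrix n n ℂ} (hA : A.IsHermitian) (z w : ℂ) :
    cp hA (z + w) = cp hA z * cp hA w := by
  unfold cp
  have : ∀ (U D E V : Matrix n n ℂ), V * U = 1 → (U * D * V) * (U * E * V) = U * (D * E) * V := by
    intro U D E V h
    calc _ = U * D * (V * U) * E * V := by simp only [Matrix.mul_assoc]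
      _ = _ := by rw [h]; simp only [Matrix.mul_assoc, Matrix.one_mul]
  rw [this _ _ _ _ (eig_mul hA), diagonal_mul_diagonal]
  simp only [gp_add]

lemma cp_conj {A : Matrix n n ℂ} (hA : A.IsHermitian) (z : ℂ) :
    (cp hA z)ᴴ = cp hA (star z) := by
  unfold cp
  simp only [conjTranspose_mul, conjTranspose_conjTranspose, diagonal_conjTranspose,
    Matrix.mul_assoc]
  congr 3
  ext i
  simp only [Pi.star_apply, gp_conj]

lemma cp_one {A : Matrix n n ℂ} (hA : A.PosSemidef) : cp hA.1 1 = A := by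
  conv_rhs => rw [hA.1.spectral_theorem]
  rw [Unitary.conjStarAlgAut_apply]
  unfold cp
  congr 3
  ext i
  have := gp_real (hA.eigenvalues_nonneg i) one_ne_zero
  simpa using this

lemma cp_zero {A : Matrix n n ℂ} (hA : A.PosDef) : cp hA.1 0 = 1 := by
  unfold cp
  have : (fun i => gp (hA.1.eigenvalues i) 0) = fun _ => 1 := by
    ext i
    simp [gp, (hA.eigenvalues_pos i).ne']
  rw [this, diagonal_one, Matrix.mul_one, eig_mul']

lemma mpow_eq {A : Matrix n n ℂ} (hA : A.PosSemidef) {x : ℝ} (hx : x ≠ 0) :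
    mpow A x = cp hA.1 x := by
  rw [mpow, dif_pos hA.1, IsHermitian.cfc, Unitary.conjStarAlgAut_apply]
  unfold cp
  congr 3
  ext i
  simpa using (gp_real (hA.eigenvalues_nonneg i) hx).symm

/-- squared Hilbert-Schmidt norm -/
noncomputable def hs (X : Matrix n n ℂ) : ℝ := (trace (Xᴴ * X)).re

lemma hs_eq (X : Matrix n n ℂ) : hs X = ∑ i, ∑ j, ‖X i j‖ ^ 2 := by
  unfold hs
  rw [Finset.sum_comm]
  simp only [trace, diag, mul_apply, conjTranspose_apply, Complex.re_sum]
  refine Finset.sum_congr rfl fun i _ => Finset.sum_congr rfl fun j _ => ?_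
  rw [Complex.star_def, ← Complex.normSq_eq_conj_mul_self, Complex.ofReal_re,
    Complex.normSq_eq_norm_sq]

lemma hs_nonneg (X : Matrix n n ℂ) : 0 ≤ hs X := by
  rw [hs_eq]; positivity

lemma hs_conj (X : Matrix n n ℂ) : hs Xᴴ = hs X := by
  unfold hs
  rw [conjTranspose_conjTranspose, trace_mul_comm]

lemma eq_zero_of_hs {X : Matrix n n ℂ} (h : X * Xᴴ = 0) : X = 0 := by
  have h0 : hs Xᴴ = 0 := by unfold hs; rw [conjTranspose_conjTranspose, h]; simp
  rw [hs_conj, hs_eq] at h0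
  have h1 := (Finset.sum_eq_zero_iff_of_nonneg (fun i _ => by positivity)).1 h0
  ext i j
  have h2 := (Finset.sum_eq_zero_iff_of_nonneg (fun i _ => by positivity)).1 (h1 i (by simp)) j
    (by simp)
  simpa using h2

/-- partial isometries -/
def PI (X : Matrix n n ℂ) : Prop := X * Xᴴ * X = X

lemma PI.conj {X : Matrix n n ℂ} (h : PI X) : PI Xᴴ := by
  unfold PI at *
  have := congrArg conjTranspose h
  simpa [Matrix.mul_assoc] using this

lemma PI.hs_mul_le {X : Matrix n n ℂ} (h : PI X) (Y : Matrix n n ℂ) : hs (X * Y) ≤ hs Y := by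
  have key : hs Y = hs (X * Y) + hs (Y - Xᴴ * X * Y) := by
    unfold hs
    rw [← Complex.add_re, ← trace_add]
    congr 2
    have e : Xᴴ * (X * (Xᴴ * (X * Y))) = Xᴴ * (X * Y) := by
      have : X * (Xᴴ * (X * Y)) = X * Xᴴ * X * Y := by simp only [Matrix.mul_assoc]
      rw [this, h]
    simp only [conjTranspose_mul, conjTranspose_sub, conjTranspose_conjTranspose,
      Matrix.sub_mul, Matrix.mul_sub, Matrix.mul_assoc, e]
    abel
  have := hs_nonneg (Y - Xᴴ * X * Y)
  linarith

lemma PI.hs_mul_le' {X : Matrix n n ℂ} (h : PI X) (Y : Matrix n n ℂ) : hs (Y * X) ≤ hs Y := by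
  rw [← hs_conj, ← hs_conj Y, conjTranspose_mul]
  exact h.conj.hs_mul_le _

lemma cp_PI {A : Matrix n n ℂ} (hA : A.IsHermitian) {z : ℂ} (hz : z.re = 0) : PI (cp hA z) := by
  unfold PI
  rw [cp_conj, ← cp_add, ← cp_add]
  congr 1
  apply Complex.ext <;> simp [hz]

lemma hs_cp {A : Matrix n n ℂ} (hA : A.IsHermitian) (z : ℂ) :
    hs (cp hA z) = (trace (cp hA ((2 * z.re : ℝ) : ℂ))).re := by
  unfold hs
  rw [cp_conj, ← cp_add]
  congr 3
  apply Complex.ext <;> simp; ring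

lemma PI_one : PI (1 : Matrix n n ℂ) := by simp [PI]

/-- polar decomposition -/
lemma polar (M : Matrix n n ℂ) {H : Matrix n n ℂ} (h : H.IsHermitian) (hp : H.PosSemidef)
    (hMH : M * Mᴴ = H) :
    ∃ V, PI V ∧ cp h (1 / 2 : ℝ) * V = M ∧ M * Vᴴ = cp h (1 / 2 : ℝ) := by
  have h1 : M * Mᴴ = cp h 1 := hMH.trans (cp_one hp).symm
  have h0 : cp h 0 * M = M := by
    rw [← sub_eq_zero]
    apply eq_zero_of_hs
    have e : cp h 0 * M - M = (cp h 0 - 1) * M := by rw [Matrix.sub_mul, Matrix.one_mul]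
    rw [e, conjTranspose_mul, Matrix.mul_assoc, ← Matrix.mul_assoc M, h1, ← Matrix.mul_assoc,
      Matrix.sub_mul, ← cp_add]
    simp
  have hc : (cp h ((-(1 / 2) : ℝ) : ℂ))ᴴ = cp h ((-(1 / 2) : ℝ) : ℂ) := by
    rw [cp_conj]; simp
  have hM : M * (cp h ((-(1 / 2) : ℝ) : ℂ) * M)ᴴ = cp h (1 / 2 : ℝ) := by
    rw [conjTranspose_mul, ← Matrix.mul_assoc, h1, hc, ← cp_add]
    congr 1; push_cast; ring
  refine ⟨cp h ((-(1 / 2) : ℝ) : ℂ) * M, ?_, ?_, hM⟩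
  · unfold PI
    rw [Matrix.mul_assoc (cp h _), hM, ← cp_add, ← Matrix.mul_assoc, ← cp_add]
    congr 2; push_cast; ring
  · rw [← Matrix.mul_assoc, ← cp_add]
    conv_rhs => rw [← h0]
    congr 2; push_cast; ring

/-- entire functions bounded on the strip -/
def SNice (f : ℂ → ℂ) : Prop :=
  Differentiable ℂ f ∧ ∃ B : ℝ, ∀ z : ℂ, 0 ≤ z.re → z.re ≤ 1 → ‖f z‖ ≤ B

lemma SNice.const (c : ℂ) : SNice (fun _ => c) :=
  ⟨differentiable_const c, ‖c‖, fun _ _ _ => le_rfl⟩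

lemma SNice.mul {f g : ℂ → ℂ} (hf : SNice f) (hg : SNice g) : SNice (fun z => f z * g z) := by
  obtain ⟨hf, B, hB⟩ := hf
  obtain ⟨hg, B', hB'⟩ := hg
  refine ⟨hf.mul hg, B * B', fun z h0 h1 => ?_⟩
  rw [norm_mul]
  exact mul_le_mul (hB z h0 h1) (hB' z h0 h1) (norm_nonneg _) ((norm_nonneg _).trans (hB z h0 h1))

lemma SNice.sum {κ : Type*} (s : Finset κ) {f : κ → ℂ → ℂ} (hf : ∀ k, SNice (f k)) :
    SNice (fun z => ∑ k ∈ s, f k z) := by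
  choose h B hB using hf
  refine ⟨Differentiable.fun_sum fun k _ => h k, ∑ k ∈ s, B k, fun z h0 h1 => ?_⟩
  exact (norm_sum_le _ _).trans (Finset.sum_le_sum fun k _ => hB k z h0 h1)

lemma SNice.gp (l : ℝ) (c e : ℝ) : SNice (fun z => gp l (c * z + e)) := by
  unfold FPQ.gp
  split_ifs
  · exact SNice.const 0
  · refine ⟨by fun_prop, Real.exp ((|c| + |e|) * |Real.log l|), fun z h0 h1 => ?_⟩
    rw [Complex.norm_exp]
    apply Real.exp_le_exp.2
    have : ((c * z + e) * (Real.log l : ℝ) : ℂ).re = (c * z.re + e) * Real.log l := by simp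
    rw [this]
    refine (le_abs_self _).trans ?_
    rw [abs_mul]
    gcongr
    refine (abs_add_le _ _).trans ?_
    refine add_le_add ?_ le_rfl
    rw [abs_mul, abs_of_nonneg h0]
    nlinarith [abs_nonneg c]

/-- matrix version -/
def MNice (X : ℂ → Matrix n n ℂ) : Prop := ∀ i j, SNice (fun z => X z i j)

lemma MNice.const (X : Matrix n n ℂ) : MNice (fun _ => X) := fun _ _ => SNice.const _

lemma MNice.mul {X Y : ℂ → Matrix n n ℂ} (hX : MNice X) (hY : MNice Y) :
    MNice (fun z => X z * Y z) := by
  intro i j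
  simp only [mul_apply]
  exact SNice.sum _ fun k => (hX i k).mul (hY k j)

lemma MNice.cp {A : Matrix n n ℂ} (hA : A.IsHermitian) (c e : ℝ) :
    MNice (fun z => cp hA (c * z + e)) := by
  unfold FPQ.cp
  refine MNice.mul (MNice.mul (MNice.const _) ?_) (MNice.const _)
  intro i j
  by_cases h : i = j
  · subst h
    simpa using SNice.gp _ c e
  · simpa [diagonal_apply_ne _ h] using SNice.const 0

lemma three_lines {ι : Type*} [Fintype ι] (t : ι → ℝ) (ht : ∀ k, 0 ≤ t k)
    (X : ι → ℂ → Matrix n n ℂ) (hX : ∀ k, MNice (X k)) {a b : ℝ}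
    (ha : ∀ z : ℂ, z.re = 0 → ∑ k, t k * hs (X k z) ≤ a)
    (hb : ∀ z : ℂ, z.re = 1 → ∑ k, t k * hs (X k z) ≤ b)
    (x : ℝ) (hx0 : 0 ≤ x) (hx1 : x ≤ 1) :
    ∑ k, t k * hs (X k x) ≤ a ^ (1 - x) * b ^ x := by
  have hpos : ∀ z, 0 ≤ ∑ k, t k * hs (X k z) :=
    fun z => Finset.sum_nonneg fun k _ => mul_nonneg (ht k) (hs_nonneg _)
  have ha0 : 0 ≤ a := (hpos _).trans (ha 0 (by simp))
  have hb0 : 0 ≤ b := (hpos _).trans (hb 1 (by simp))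
  let F : ℂ → EuclideanSpace ℂ (ι × n × n) := fun z =>
    WithLp.toLp 2 fun k => (Real.sqrt (t k.1) : ℂ) * X k.1 z k.2.1 k.2.2
  have hF : ∀ z, ‖F z‖ ^ 2 = ∑ k, t k * hs (X k z) := by
    intro z
    rw [EuclideanSpace.norm_sq_eq, Fintype.sum_prod_type]
    refine Finset.sum_congr rfl fun k _ => ?_
    rw [hs_eq, Fintype.sum_prod_type, Finset.mul_sum]
    refine Finset.sum_congr rfl fun i _ => ?_
    rw [Finset.mul_sum]
    refine Finset.sum_congr rfl fun j _ => ?_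
    simp only [F, norm_mul, mul_pow, Complex.norm_real, Real.norm_eq_abs, sq_abs]
    rw [Real.sq_sqrt (ht k)]
  have hdiff : Differentiable ℂ F := by
    rw [differentiable_euclidean]
    intro k
    exact ((hX k.1 k.2.1 k.2.2).1).const_mul _
  have hbdd : BddAbove ((norm ∘ F) '' Complex.HadamardThreeLines.verticalClosedStrip 0 1) := by
    have hn : ∀ k : ι × n × n, ∃ B : ℝ, ∀ z : ℂ, 0 ≤ z.re → z.re ≤ 1 → ‖F z k‖ ≤ B := by
      intro k
      exact ((SNice.const (Real.sqrt (t k.1) : ℂ)).mul (hX k.1 k.2.1 k.2.2)).2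
    choose B hB using hn
    refine ⟨Real.sqrt (∑ k, B k ^ 2), ?_⟩
    rintro _ ⟨z, hz, rfl⟩
    simp only [Complex.HadamardThreeLines.verticalClosedStrip, Set.mem_preimage, Set.mem_Icc] at hz
    simp only [Function.comp, EuclideanSpace.norm_eq]
    apply Real.sqrt_le_sqrt
    refine Finset.sum_le_sum fun k _ => ?_
    exact pow_le_pow_left₀ (norm_nonneg _) (hB k z hz.1 hz.2) 2
  have main := Complex.HadamardThreeLines.norm_le_interp_of_mem_verticalClosedStrip₀₁' F
    (z := (x : ℂ)) (a := Real.sqrt a) (b := Real.sqrt b)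
    (by simp [Complex.HadamardThreeLines.verticalClosedStrip, hx0, hx1])
    hdiff.diffContOnCl hbdd
    (fun z hz => Real.le_sqrt_of_sq_le (by rw [hF]; exact ha z (by simpa using hz)))
    (fun z hz => Real.le_sqrt_of_sq_le (by rw [hF]; exact hb z (by simpa using hz)))
  rw [Complex.ofReal_re] at main
  rw [← hF]
  refine (pow_le_pow_left₀ (norm_nonneg _) main 2).trans (le_of_eq ?_)
  rw [mul_pow, ← Real.rpow_natCast, ← Real.rpow_mul (Real.sqrt_nonneg _), ← Real.rpow_natCast,
    ← Real.rpow_mul (Real.sqrt_nonneg _), mul_comm (1 - x), mul_comm x,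
    Real.rpow_mul (Real.sqrt_nonneg _), Real.rpow_mul (Real.sqrt_nonneg _)]
  simp [Real.sq_sqrt ha0, Real.sq_sqrt hb0]

lemma core {ι : Type*} [Fintype ι] (t : ι → ℝ) (ht : ∀ k, 0 ≤ t k) (s : ℝ)
    (A H V : ι → Matrix n n ℂ) (C H0 U : Matrix n n ℂ)
    (hA : ∀ k, (A k).PosDef) (hC : C.PosDef) (hsum : ∑ k, (t k) • A k = C)
    (hH : ∀ k, (H k).IsHermitian) (hH0 : H0.IsHermitian) (hV : ∀ k, PI (V k)) (hU : PI U)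
    (x : ℝ) (hx0 : 0 ≤ x) (hx1 : x ≤ 1) :
    ∑ k, t k * hs (cp (hH k) ((s * ((1 - x) / 2) : ℝ) : ℂ) * (V k * (cp (hA k).1 ((x / 2 : ℝ) : ℂ) *
      (cp hC.1 ((-(x / 2) : ℝ) : ℂ) * (U * cp hH0 ((s * (x / 2) : ℝ) : ℂ)))))) ≤
    (∑ k, t k * (trace (cp (hH k) s)).re) ^ (1 - x) * (trace (cp hH0 s)).re ^ x := by
  let X : ι → ℂ → Matrix n n ℂ := fun k z =>
    cp (hH k) ((-(s / 2) : ℝ) * z + (s / 2 : ℝ)) * (V k * (cp (hA k).1 ((1 / 2 : ℝ) * z + (0 : ℝ)) *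
      (cp hC.1 ((-(1 / 2) : ℝ) * z + (0 : ℝ)) * (U * cp hH0 ((s / 2 : ℝ) * z + (0 : ℝ))))))
  have hX : ∀ k, MNice (X k) := fun k =>
    (MNice.cp _ _ _).mul ((MNice.const _).mul ((MNice.cp _ _ _).mul ((MNice.cp _ _ _).mul
      ((MNice.const _).mul (MNice.cp _ _ _)))))
  have := three_lines t ht X hX (a := ∑ k, t k * (trace (cp (hH k) s)).re)
    (b := (trace (cp hH0 s)).re) ?_ ?_ x hx0 hx1
  · refine le_trans (le_of_eq ?_) this
    refine Finset.sum_congr rfl fun k _ => ?_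
    simp only [X]
    have c1 : ((s * ((1 - x) / 2) : ℝ) : ℂ) = (-(s / 2) : ℝ) * (x : ℂ) + (s / 2 : ℝ) := by
      push_cast; ring
    have c2 : ((x / 2 : ℝ) : ℂ) = (1 / 2 : ℝ) * (x : ℂ) + (0 : ℝ) := by push_cast; ring
    have c3 : ((-(x / 2) : ℝ) : ℂ) = (-(1 / 2) : ℝ) * (x : ℂ) + (0 : ℝ) := by push_cast; ring
    have c4 : ((s * (x / 2) : ℝ) : ℂ) = (s / 2 : ℝ) * (x : ℂ) + (0 : ℝ) := by push_cast; ring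
    rw [c1, c2, c3, c4]
  · intro z hz
    refine Finset.sum_le_sum fun k _ => mul_le_mul_of_nonneg_left ?_ (ht k)
    simp only [X]
    simp only [← Matrix.mul_assoc]
    refine ((cp_PI hH0 (by simp [hz])).hs_mul_le' _).trans ?_
    refine (hU.hs_mul_le' _).trans ?_
    refine ((cp_PI hC.1 (by simp [hz])).hs_mul_le' _).trans ?_
    refine ((cp_PI (hA k).1 (by simp [hz])).hs_mul_le' _).trans ?_
    refine ((hV k).hs_mul_le' _).trans ?_
    rw [hs_cp]
    apply le_of_eq
    congr 4
    simp [hz]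
    ring
  · intro z hz
    set Y := U * cp hH0 ((s / 2 : ℝ) * z + (0 : ℝ)) with hY
    have h1 : ∀ k, t k * hs (X k z) ≤
        t k * hs (cp (hA k).1 ((1 / 2 : ℝ) * z + (0 : ℝ)) *
          (cp hC.1 ((-(1 / 2) : ℝ) * z + (0 : ℝ)) * Y)) := by
      intro k
      refine mul_le_mul_of_nonneg_left ?_ (ht k)
      simp only [X]
      refine ((cp_PI (hH k) (by simp [hz])).hs_mul_le _).trans ?_
      exact (hV k).hs_mul_le _
    refine (Finset.sum_le_sum fun k _ => h1 k).trans ?_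
    have h2 : ∑ k, t k * hs (cp (hA k).1 ((1 / 2 : ℝ) * z + (0 : ℝ)) *
          (cp hC.1 ((-(1 / 2) : ℝ) * z + (0 : ℝ)) * Y)) = hs Y := by
      set Z := cp hC.1 ((-(1 / 2) : ℝ) * z + (0 : ℝ)) with hZ
      have e : ∀ k, t k * hs (cp (hA k).1 ((1 / 2 : ℝ) * z + (0 : ℝ)) * (Z * Y)) =
          (trace ((Z * Y)ᴴ * (t k • A k) * (Z * Y))).re := by
        intro k
        have e1 : (cp (hA k).1 ((1 / 2 : ℝ) * z + (0 : ℝ)))ᴴ *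
            cp (hA k).1 ((1 / 2 : ℝ) * z + (0 : ℝ)) = A k := by
          rw [cp_conj, ← cp_add]
          conv_rhs => rw [← cp_one (hA k).posSemidef]
          congr 1
          apply Complex.ext <;> simp [hz]
          norm_num
        unfold hs
        rw [conjTranspose_mul (cp _ _), Matrix.mul_assoc, ← Matrix.mul_assoc _ (cp _ _), e1]
        simp [Matrix.mul_assoc]
      simp only [e]
      rw [← Complex.re_sum, ← trace_sum, ← Finset.sum_mul, ← Finset.mul_sum, hsum]
      have e2 : Zᴴ * C * Z = 1 := by
        have hC1 : C = cp hC.1 1 := (cp_one hC.posSemidef).symm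
        have hC2 : Zᴴ * C * Z = Zᴴ * cp hC.1 1 * Z := congrArg (fun D => Zᴴ * D * Z) hC1
        rw [hC2, hZ, cp_conj, ← cp_add, ← cp_add, ← cp_zero hC]
        congr 1
        apply Complex.ext <;> simp [hz]
        norm_num
      unfold hs
      have : (Z * Y)ᴴ * C * (Z * Y) = Yᴴ * (Zᴴ * C * Z) * Y := by
        simp [conjTranspose_mul, Matrix.mul_assoc]
      rw [this, e2, Matrix.mul_one]
    rw [h2]
    refine (hU.hs_mul_le _).trans ?_
    rw [hs_cp]
    apply le_of_eq
    congr 4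
    simp [hz]
    ring

lemma cauchy {ι : Type*} [Fintype ι] (t : ι → ℝ) (ht : ∀ k, 0 ≤ t k)
    (X Y : ι → Matrix n n ℂ) :
    (∑ k, t k * (trace (X k * Y k)).re) ^ 2 ≤ (∑ k, t k * hs (X k)) * (∑ k, t k * hs (Y k)) := by
  let F : (ι → Matrix n n ℂ) → EuclideanSpace ℂ (ι × n × n) := fun X =>
    WithLp.toLp 2 fun k => (Real.sqrt (t k.1) : ℂ) * X k.1 k.2.1 k.2.2
  have hF : ∀ X, ‖F X‖ ^ 2 = ∑ k, t k * hs (X k) := by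
    intro X
    rw [EuclideanSpace.norm_sq_eq, Fintype.sum_prod_type]
    refine Finset.sum_congr rfl fun k _ => ?_
    rw [hs_eq, Fintype.sum_prod_type, Finset.mul_sum]
    refine Finset.sum_congr rfl fun i _ => ?_
    rw [Finset.mul_sum]
    refine Finset.sum_congr rfl fun j _ => ?_
    simp only [F, norm_mul, mul_pow, Complex.norm_real, Real.norm_eq_abs, sq_abs]
    rw [Real.sq_sqrt (ht k)]
  have hI : (inner ℂ (F fun k => (X k)ᴴ) (F Y)).re = ∑ k, t k * (trace (X k * Y k)).re := by
    rw [PiLp.inner_apply, Fintype.sum_prod_type, Complex.re_sum]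
    refine Finset.sum_congr rfl fun k _ => ?_
    have : (trace (X k * Y k)).re = (∑ i, ∑ j, X k j i * Y k i j).re := by
      rw [Finset.sum_comm]; simp only [trace, diag, mul_apply]
    rw [this, Fintype.sum_prod_type, ← Complex.re_ofReal_mul, Finset.mul_sum]
    congr 1
    refine Finset.sum_congr rfl fun i _ => ?_
    rw [Finset.mul_sum]
    refine Finset.sum_congr rfl fun j _ => ?_
    have h2 : (Real.sqrt (t k) : ℂ) * (Real.sqrt (t k) : ℂ) = (t k : ℂ) := by
      rw [← Complex.ofReal_mul, Real.mul_self_sqrt (ht k)]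
    simp only [F, RCLike.inner_apply, conjTranspose_apply, map_mul, Complex.conj_ofReal,
      Complex.star_def, Complex.conj_conj]
    rw [← h2]; ring
  have hh : ∑ k, t k * hs (X k) = ‖F fun k => (X k)ᴴ‖ ^ 2 := by
    have := hF fun k => (X k)ᴴ
    rw [this]; simp only [hs_conj]
  rw [hh, ← hF Y, ← hI, ← mul_pow]
  apply sq_le_sq'
  · have := (abs_le.1 ((Complex.abs_re_le_norm _).trans
      (norm_inner_le_norm (𝕜 := ℂ) (F fun k => (X k)ᴴ) (F Y)))).1
    exact this
  · exact (Complex.re_le_norm _).trans (norm_inner_le_norm _ _)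

lemma le_of_pow {a b p q : ℝ} (ha : 0 ≤ a) (hb : 0 ≤ b) (hp : 0 < p) (hq : 0 < q)
    (h : a ^ 2 ≤ (a ^ (1 - p) * b ^ p) * (a ^ (1 - q) * b ^ q)) : a ≤ b := by
  by_contra hlt
  push Not at hlt
  have ha' : 0 < a := hb.trans_lt hlt
  have h1 : (a ^ (1 - p) * b ^ p) < a := by
    calc _ < a ^ (1 - p) * a ^ p := by
          apply mul_lt_mul_of_pos_left _ (Real.rpow_pos_of_pos ha' _)
          exact Real.rpow_lt_rpow hb hlt hp
      _ = a := by rw [← Real.rpow_add ha']; simp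
  have h2 : (a ^ (1 - q) * b ^ q) < a := by
    calc _ < a ^ (1 - q) * a ^ q := by
          apply mul_lt_mul_of_pos_left _ (Real.rpow_pos_of_pos ha' _)
          exact Real.rpow_lt_rpow hb hlt hq
      _ = a := by rw [← Real.rpow_add ha']; simp
  have h3 : 0 ≤ (a ^ (1 - p) * b ^ p) := by positivity
  have h4 : 0 ≤ (a ^ (1 - q) * b ^ q) := by positivity
  nlinarith

lemma trace_cp_nonneg {A : Matrix n n ℂ} (hA : A.IsHermitian) (s : ℝ) :
    0 ≤ (trace (cp hA s)).re := by
  have := hs_cp hA ((s / 2 : ℝ) : ℂ)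
  rw [Complex.ofReal_re, mul_div_cancel₀ s two_ne_zero] at this
  rw [← this]
  exact hs_nonneg _

lemma cp_conj_real {A : Matrix n n ℂ} (hA : A.IsHermitian) (x : ℝ) :
    (cp hA (x : ℂ))ᴴ = cp hA (x : ℂ) := by
  rw [cp_conj]; simp

lemma main {ι : Type*} [Fintype ι] (t : ι → ℝ) (ht : ∀ k, 0 ≤ t k) (p q : ℝ)
    (hp0 : 0 < p) (hp1 : p ≤ 1) (hq0 : 0 < q) (hq1 : q ≤ 1)
    (A : ι → Matrix n n ℂ) (C K : Matrix n n ℂ)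
    (hA : ∀ k, (A k).PosDef) (hC : C.PosDef) (hsum : ∑ k, (t k) • A k = C)
    (M H : ι → Matrix n n ℂ) (M0 H0 : Matrix n n ℂ)
    (hM : ∀ k, M k = cp (hA k).1 (p / 2 : ℝ) * K * cp (hA k).1 (q / 2 : ℝ))
    (hM0 : M0 = cp hC.1 (p / 2 : ℝ) * K * cp hC.1 (q / 2 : ℝ))
    (hMH : ∀ k, M k * (M k)ᴴ = H k) (hMH0 : M0 * M0ᴴ = H0)
    (hH : ∀ k, (H k).PosSemidef) (hH0 : H0.PosSemidef) :
    ∑ k, t k * (trace (cp (hH k).1 (1 / (p + q) : ℝ))).re ≤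
      (trace (cp hH0.1 (1 / (p + q) : ℝ))).re := by
  set s : ℝ := 1 / (p + q) with hs_def
  have hs' : s * p + s * q = 1 := by rw [hs_def]; field_simp
  choose V hV hV1 hV2 using fun k => polar (M k) (hH k).1 (hH k) (hMH k)
  obtain ⟨U, hU, hU1, hU2⟩ := polar M0 hH0.1 hH0 hMH0
  have b1 := core t ht s A H (fun _ => 1) C H0 1 hA hC hsum (fun k => (hH k).1) hH0.1
    (fun _ => PI_one) PI_one p hp0.le hp1
  have b2 := core t ht s A H V C H0 Uᴴ hA hC hsum (fun k => (hH k).1) hH0.1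
    hV hU.conj q hq0.le hq1
  set X : ι → Matrix n n ℂ := fun k => cp (hH k).1 ((s * ((1 - p) / 2) : ℝ) : ℂ) *
    (1 * (cp (hA k).1 ((p / 2 : ℝ) : ℂ) *
      (cp hC.1 ((-(p / 2) : ℝ) : ℂ) * (1 * cp hH0.1 ((s * (p / 2) : ℝ) : ℂ))))) with hX
  set Y : ι → Matrix n n ℂ := fun k => cp (hH k).1 ((s * ((1 - q) / 2) : ℝ) : ℂ) *
    (V k * (cp (hA k).1 ((q / 2 : ℝ) : ℂ) *
      (cp hC.1 ((-(q / 2) : ℝ) : ℂ) * (Uᴴ * cp hH0.1 ((s * (q / 2) : ℝ) : ℂ))))) with hY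
  have hK : cp hC.1 ((-(p / 2) : ℝ) : ℂ) * M0 * cp hC.1 ((-(q / 2) : ℝ) : ℂ) = K := by
    have e1 : cp hC.1 ((-(p / 2) : ℝ) : ℂ) * cp hC.1 ((p / 2 : ℝ) : ℂ) = 1 := by
      rw [← cp_add, ← cp_zero hC]; congr 1; push_cast; ring
    have e2 : cp hC.1 ((q / 2 : ℝ) : ℂ) * cp hC.1 ((-(q / 2) : ℝ) : ℂ) = 1 := by
      rw [← cp_add, ← cp_zero hC]; congr 1; push_cast; ring
    rw [hM0]
    calc _ = (cp hC.1 ((-(p / 2) : ℝ) : ℂ) * cp hC.1 ((p / 2 : ℝ) : ℂ)) * K *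
        (cp hC.1 ((q / 2 : ℝ) : ℂ) * cp hC.1 ((-(q / 2) : ℝ) : ℂ)) := by
          simp only [Matrix.mul_assoc]
      _ = K := by rw [e1, e2, Matrix.one_mul, Matrix.mul_one]
  have key : ∀ k, X k * (Y k)ᴴ = cp (hH k).1 (s : ℂ) := by
    intro k
    have e3 : cp hH0.1 ((s * (p / 2) : ℝ) : ℂ) * cp hH0.1 ((s * (q / 2) : ℝ) : ℂ) =
        cp hH0.1 (1 / 2 : ℝ) := by
      rw [← cp_add, ← Complex.ofReal_add]
      congr 2; linarith
    simp only [hX, hY, conjTranspose_mul, cp_conj_real, conjTranspose_conjTranspose,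
      Matrix.one_mul]
    calc _ = cp (hH k).1 ((s * ((1 - p) / 2) : ℝ) : ℂ) * ((cp (hA k).1 ((p / 2 : ℝ) : ℂ) *
          (cp hC.1 ((-(p / 2) : ℝ) : ℂ) * ((cp hH0.1 ((s * (p / 2) : ℝ) : ℂ) *
            cp hH0.1 ((s * (q / 2) : ℝ) : ℂ)) * U) * cp hC.1 ((-(q / 2) : ℝ) : ℂ)) *
          cp (hA k).1 ((q / 2 : ℝ) : ℂ)) * (V k)ᴴ) *
          cp (hH k).1 ((s * ((1 - q) / 2) : ℝ) : ℂ) := by simp only [Matrix.mul_assoc]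
      _ = _ := by
        rw [e3, hU1, hK, ← hM k, hV2, ← cp_add, ← cp_add, ← Complex.ofReal_add,
          ← Complex.ofReal_add]
        congr 2; linarith
  have hc := cauchy t ht X (fun k => (Y k)ᴴ)
  simp only [key, hs_conj] at hc
  refine le_of_pow (Finset.sum_nonneg fun k _ => mul_nonneg (ht k) (trace_cp_nonneg _ _))
    (trace_cp_nonneg _ _) hp0 hq0 (hc.trans ?_)
  exact mul_le_mul b1 b2 (Finset.sum_nonneg fun k _ => mul_nonneg (ht k) (hs_nonneg _))
    (le_trans (Finset.sum_nonneg fun k _ => mul_nonneg (ht k) (hs_nonneg _)) b1)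

lemma fpq_eq {p q : ℝ} (hp : 0 < p) (hq : 0 < q) (K : Matrix n n ℂ) {A : Matrix n n ℂ}
    (hA : A.PosDef) {M H : Matrix n n ℂ}
    (hM : M = cp hA.1 (p / 2 : ℝ) * K * cp hA.1 (q / 2 : ℝ)) (hMH : M * Mᴴ = H)
    (hH : H.PosSemidef) : fpq p q K A = (trace (cp hH.1 (1 / (p + q) : ℝ))).re := by
  have e : mpow A (p / 2) * K * mpow A q * Kᴴ * mpow A (p / 2) = H := by
    rw [mpow_eq hA.posSemidef (by positivity), mpow_eq hA.posSemidef hq.ne', ← hMH, hM]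
    have : cp hA.1 (q : ℂ) = cp hA.1 ((q / 2 : ℝ) : ℂ) * cp hA.1 ((q / 2 : ℝ) : ℂ) := by
      rw [← cp_add]; congr 1; push_cast; ring
    rw [this]
    simp only [conjTranspose_mul, cp_conj_real, Matrix.mul_assoc]
  rw [fpq, e, mpow_eq hH (by positivity)]

end
end FPQ

/-- Hiai's concavity theorem: for 0 < p ≤ 1 and 0 < q ≤ 1 and fixed K, the functional
`A ↦ f_{p,q}(A;K)` is concave on positive definite matrices. -/
theorem fpq_concave {d : ℕ} (p q : ℝ) (hp0 : 0 < p) (hp1 : p ≤ 1) (hq0 : 0 < q) (hq1 : q ≤ 1)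
    (K : Matrix (Fin d) (Fin d) ℂ)
    (A₁ A₂ : Matrix (Fin d) (Fin d) ℂ) (hA₁ : A₁.PosDef) (hA₂ : A₂.PosDef)
    (t : ℝ) (ht0 : 0 ≤ t) (ht1 : t ≤ 1) :
    t * fpq p q K A₁ + (1 - t) * fpq p q K A₂ ≤ fpq p q K (t • A₁ + (1 - t) • A₂) := by
  have hC : (t • A₁ + (1 - t) • A₂).PosDef := by
    rcases ht0.eq_or_lt with h | h
    · subst h; simpa using hA₂
    · exact (hA₁.smul h).add_posSemidef (hA₂.posSemidef.smul (by linarith))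
  let A : Bool → Matrix (Fin d) (Fin d) ℂ := fun b => if b then A₁ else A₂
  let w : Bool → ℝ := fun b => if b then t else 1 - t
  have hA : ∀ k, (A k).PosDef := by
    rintro (_ | _)
    · exact hA₂
    · exact hA₁
  have hw : ∀ k, 0 ≤ w k := by
    rintro (_ | _)
    · simp only [w]; simpa using ht1
    · simpa [w] using ht0
  have := FPQ.main w hw p q hp0 hp1 hq0 hq1 A _ K hA hC (by simp [w, A]) _ _ _ _
    (fun _ => rfl) rfl (fun _ => rfl) rfl (fun _ => posSemidef_self_mul_conjTranspose _)
    (posSemidef_self_mul_conjTranspose _)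
  rw [FPQ.fpq_eq hp0 hq0 K hC rfl rfl (posSemidef_self_mul_conjTranspose _)]
  refine le_trans (le_of_eq ?_) this
  rw [Fintype.sum_bool]
  have e : ∀ k, fpq p q K (A k) = _ := fun k =>
    FPQ.fpq_eq hp0 hq0 K (hA k) rfl rfl (posSemidef_self_mul_conjTranspose _)
  have e1 : fpq p q K A₁ = _ := e true
  have e2 : fpq p q K A₂ = _ := e false
  rw [e1, e2]
  rfl
end

section
/- Let ρ and σ be positive definite d×d complex matrices and let r be a non-zero real number. Then, as α → 1 (α ≠ 1), the matrix (ρ^{α/(2r(α−1))} σ^{−1/r} ρ^{α/(2r(α−1))})^{r(α−1)} converges to ρ. -/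
open Matrix Filter
open scoped ComplexOrder

section Abstract

open scoped Topology

variable {A : Type*} [CStarAlgebra A] [PartialOrder A] [StarOrderedRing A]

lemma aux_smul_rpow {a : A} (ha : IsStrictlyPositive a) {c : ℝ} (hc : 0 < c) (y : ℝ) :
    (c • a) ^ y = (c ^ y) • a ^ y := by
  have hpos : ∀ x ∈ spectrum ℝ a, 0 < x := fun x hx => ha.spectrum_pos hx
  have h1 : c • a = cfc (fun x : ℝ => c * x) a := by
    rw [cfc_const_mul c (fun x : ℝ => x) a, cfc_id' ℝ a]
  have hcont : ContinuousOn (fun x : ℝ => x ^ y) (spectrum ℝ a) :=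
    ContinuousOn.rpow_const (by fun_prop) (fun x hx => Or.inl (hpos x hx).ne')
  rw [h1, CFC.cfc_rpow (fun x hx => mul_pos hc (hpos x hx)),
    CFC.rpow_eq_cfc_real ha.nonneg, ← cfc_const_mul (c ^ y) (fun x : ℝ => x ^ y) a hcont]
  refine cfc_congr fun x hx => ?_
  exact Real.mul_rpow hc.le (hpos x hx).le

lemma aux_tendsto_rpow {a : A} (ha : IsStrictlyPositive a) :
    Tendsto (fun t : ℝ => a ^ t) (𝓝 1) (𝓝 a) := by
  have hpos : ∀ x ∈ spectrum ℝ a, 0 < x := fun x hx => ha.spectrum_pos hx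
  have hcpt : IsCompact (spectrum ℝ a) := isCompact_iff_compactSpace.mpr inferInstance
  have h := tendsto_cfc_fun (a := a) (l := 𝓝 (1 : ℝ)) (F := fun (t : ℝ) (x : ℝ) => x ^ t)
    (f := fun x : ℝ => x ^ (1 : ℝ)) ?_ ?_
  · simp only [← CFC.rpow_eq_cfc_real ha.nonneg] at h
    rwa [CFC.rpow_one a ha.nonneg] at h
  · intro u hu
    have hco : ContinuousOn (Function.uncurry fun (t : ℝ) (x : ℝ) => x ^ t)
        (Set.univ ×ˢ spectrum ℝ a) := by
      refine ContinuousOn.rpow (by fun_prop) (by fun_prop) ?_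
      rintro ⟨t, x⟩ ⟨_, hx⟩
      exact Or.inl (hpos x hx).ne'
    obtain ⟨v, hv, h⟩ := hcpt.mem_uniformity_of_prod (q := 1) (u := Prod.swap ⁻¹' u) hco
      (Set.mem_univ _) (by exact tendsto_swap_uniformity hu)
    rw [nhdsWithin_univ] at hv
    filter_upwards [hv] with t ht x hx using h t ht x hx
  · exact Eventually.of_forall fun t =>
      ContinuousOn.rpow_const (by fun_prop) (fun x hx => Or.inl (hpos x hx).ne')

lemma aux_bounds [Nontrivial A] {b : A} (hb : IsStrictlyPositive b) :
    ∃ c C : ℝ, 0 < c ∧ 0 < C ∧ c • (1 : A) ≤ b ∧ b ≤ C • (1 : A) := by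
  obtain ⟨c, hc, h⟩ := (CFC.exists_pos_algebraMap_le_iff hb.isSelfAdjoint).2
    fun x hx => hb.spectrum_pos hx
  refine ⟨c, ‖b‖, hc, norm_pos_iff.2 hb.isUnit.ne_zero, ?_, ?_⟩
  · rwa [← Algebra.algebraMap_eq_smul_one]
  · rw [← Algebra.algebraMap_eq_smul_one]
    exact hb.isSelfAdjoint.le_algebraMap_norm_self

lemma aux_conj_half {a : A} (ha : IsStrictlyPositive a) (c s : ℝ) :
    a ^ s * (c • (1 : A)) * a ^ s = c • a ^ (2 * s) := by
  rw [two_mul, CFC.rpow_add ha.isUnit]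
  simp

lemma aux_conj_pos {a b : A} (ha : IsStrictlyPositive a) (hb : IsStrictlyPositive b) (s : ℝ) :
    IsStrictlyPositive (a ^ s * b * a ^ s) := by
  have h := IsStrictlyPositive.rpow a s ha
  exact (IsUnit.isStrictlyPositive_iff_conjugate_of_isSelfAdjoint b (a ^ s) h.isUnit
    h.isSelfAdjoint).2 hb

lemma aux_pos [Nontrivial A] {a b : A} (ha : IsStrictlyPositive a) (hb : IsStrictlyPositive b)
    {ι : Type*} {l : Filter ι} {e s : ι → ℝ} (he : Tendsto e l (𝓝 0))
    (hs : Tendsto (fun i => 2 * s i * e i) l (𝓝 1)) (hpos : ∀ᶠ i in l, 0 < e i) :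
    Tendsto (fun i => (a ^ s i * b * a ^ s i) ^ e i) l (𝓝 a) := by
  obtain ⟨c, C, hc, hC, hcb, hCb⟩ := aux_bounds hb
  have hlim : ∀ k : ℝ, 0 < k →
      Tendsto (fun i => k ^ e i • a ^ (2 * s i * e i)) l (𝓝 a) := by
    intro k hk
    have h1 : Tendsto (fun i => k ^ e i) l (𝓝 1) := by
      have := (tendsto_const_nhds (x := k)).rpow he (Or.inl hk.ne')
      simpa using this
    simpa using h1.smul ((aux_tendsto_rpow ha).comp hs)
  have hL := hlim c hc
  have hU := hlim C hC
  have key : ∀ᶠ i in l, c ^ e i • a ^ (2 * s i * e i) ≤ (a ^ s i * b * a ^ s i) ^ e i ∧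
      (a ^ s i * b * a ^ s i) ^ e i ≤ C ^ e i • a ^ (2 * s i * e i) := by
    have h1 : ∀ᶠ i in l, e i < 1 := he.eventually (gt_mem_nhds one_pos)
    have h2 : ∀ᶠ i in l, 0 < 2 * s i * e i := hs.eventually (lt_mem_nhds one_pos)
    filter_upwards [hpos, h1, h2] with i hi hi1 hi2
    have hsi : 2 * s i ≠ 0 := by
      intro h0
      simp [h0] at hi2
    have hx := (IsStrictlyPositive.rpow a (s i) ha).nonneg
    have hy := IsStrictlyPositive.rpow a (2 * s i) ha
    have l1 := CFC.rpow_le_rpow ⟨hi.le, hi1.le⟩ (conjugate_le_conjugate_of_nonneg hcb hx)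
    have l2 := CFC.rpow_le_rpow ⟨hi.le, hi1.le⟩ (conjugate_le_conjugate_of_nonneg hCb hx)
    rw [aux_conj_half ha, aux_smul_rpow hy hc, CFC.rpow_rpow a _ _ hsi ha] at l1
    rw [aux_conj_half ha, aux_smul_rpow hy hC, CFC.rpow_rpow a _ _ hsi ha] at l2
    exact ⟨l1, l2⟩
  have hd : Tendsto (fun i => (a ^ s i * b * a ^ s i) ^ e i - c ^ e i • a ^ (2 * s i * e i)) l
      (𝓝 0) := by
    refine squeeze_zero_norm' (a := fun i => ‖C ^ e i • a ^ (2 * s i * e i)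
      - c ^ e i • a ^ (2 * s i * e i)‖) ?_ ?_
    · filter_upwards [key] with i hi
      exact CStarAlgebra.norm_le_norm_of_nonneg_of_le (sub_nonneg.2 hi.1)
        (sub_le_sub_right hi.2 _)
    · simpa using (hU.sub hL).norm
  simpa using hd.add hL

lemma aux_neg_eq {a b : A} (ha : IsStrictlyPositive a) (hb : IsStrictlyPositive b) (s e : ℝ) :
    (a ^ s * b * a ^ s) ^ e = (a ^ (-s) * b ^ (-1 : ℝ) * a ^ (-s)) ^ (-e) := by
  have hM := aux_conj_pos ha hb s
  have hinv : a ^ (-s) * b ^ (-1 : ℝ) * a ^ (-s) = (a ^ s * b * a ^ s) ^ (-1 : ℝ) := by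
    have h1 : (a ^ (-s) * b ^ (-1 : ℝ) * a ^ (-s)) * (a ^ s * b * a ^ s) = 1 := by
      have hbb : b ^ (-1 : ℝ) * b = 1 := by
        have := CFC.rpow_neg_mul_rpow (a := b) 1 hb
        rwa [CFC.rpow_one b hb.nonneg] at this
      calc _ = a ^ (-s) * b ^ (-1 : ℝ) * (a ^ (-s) * a ^ s) * b * a ^ s := by
            simp only [mul_assoc]
        _ = a ^ (-s) * (b ^ (-1 : ℝ) * b) * a ^ s := by
            rw [CFC.rpow_neg_mul_rpow s ha]
            simp only [mul_assoc, one_mul]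
        _ = 1 := by rw [hbb, mul_one, CFC.rpow_neg_mul_rpow s ha]
    have h2 : (a ^ s * b * a ^ s) * (a ^ s * b * a ^ s) ^ (-1 : ℝ) = 1 := by
      have := CFC.rpow_mul_rpow_neg (a := a ^ s * b * a ^ s) 1 hM
      rwa [CFC.rpow_one _ hM.nonneg] at this
    exact left_inv_eq_right_inv h1 h2
  rw [hinv, CFC.rpow_rpow _ _ _ (by norm_num) hM]
  simp

lemma aux_main_s8 {a b : A} (ha : IsStrictlyPositive a) (hb : IsStrictlyPositive b)
    {ι : Type*} {l : Filter ι} {e s : ι → ℝ} (he : Tendsto e l (𝓝 0))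
    (hs : Tendsto (fun i => 2 * s i * e i) l (𝓝 1)) (hne : ∀ᶠ i in l, e i ≠ 0) :
    Tendsto (fun i => (a ^ s i * b * a ^ s i) ^ e i) l (𝓝 a) := by
  rcases subsingleton_or_nontrivial A with h | h
  · have : (fun i => (a ^ s i * b * a ^ s i) ^ e i) = fun _ => a := by
      funext i
      exact Subsingleton.elim _ _
    rw [this]
    exact tendsto_const_nhds
  have hl : l = l ⊓ 𝓟 {i | 0 < e i} ⊔ l ⊓ 𝓟 {i | 0 < e i}ᶜ := by
    rw [← inf_sup_left, sup_principal, Set.union_compl_self, principal_univ, inf_top_eq]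
  rw [hl, tendsto_sup]
  constructor
  · exact aux_pos ha hb (he.mono_left inf_le_left) (hs.mono_left inf_le_left)
      (mem_inf_of_right (mem_principal_self _))
  · simp only [aux_neg_eq ha hb]
    refine aux_pos ha (IsStrictlyPositive.rpow b (-1) hb) (e := fun i => - e i)
      (s := fun i => - s i) ?_ ?_ ?_
    · simpa using (he.mono_left inf_le_left).neg
    · simpa using hs.mono_left inf_le_left
    · filter_upwards [mem_inf_of_left hne, mem_inf_of_right (mem_principal_self _)] with i h1 h2
      have h2' : ¬ 0 < e i := h2
      have h3 := lt_of_le_of_ne (not_lt.1 h2') h1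
      linarith

end Abstract

section MatrixTransfer

open scoped MatrixOrder Matrix.Norms.L2Operator

lemma mpow_eq_rpow {d : ℕ} {X : Matrix (Fin d) (Fin d) ℂ} (hX : X.PosDef) (t : ℝ) :
    mpow X t = X ^ t := by
  have h : 0 ≤ X := hX.isStrictlyPositive.nonneg
  rw [mpow, dif_pos hX.isHermitian, ← hX.isHermitian.cfc_eq, CFC.rpow_eq_cfc_real h]

lemma tendsto_aux {d : ℕ} (ρ σ : Matrix (Fin d) (Fin d) ℂ)
    (hρ : ρ.PosDef) (hσ : σ.PosDef) (r : ℝ) (hr : r ≠ 0) :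
    Filter.Tendsto
      (fun α : ℝ => mpow
        (mpow ρ (α / (2 * r * (α - 1))) * mpow σ (-1 / r) * mpow ρ (α / (2 * r * (α - 1))))
        (r * (α - 1)))
      (nhdsWithin 1 {(1 : ℝ)}ᶜ) (nhds ρ) := by
  have hρ' := hρ.isStrictlyPositive
  have hb := IsStrictlyPositive.rpow σ (-1 / r) hσ.isStrictlyPositive
  have heq : (fun α : ℝ => mpow
        (mpow ρ (α / (2 * r * (α - 1))) * mpow σ (-1 / r) * mpow ρ (α / (2 * r * (α - 1))))
        (r * (α - 1))) = fun α : ℝ =>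
        (ρ ^ (α / (2 * r * (α - 1))) * σ ^ (-1 / r) * ρ ^ (α / (2 * r * (α - 1)))) ^
        (r * (α - 1)) := by
    funext α
    rw [mpow_eq_rpow hρ, mpow_eq_rpow hσ, mpow_eq_rpow (aux_conj_pos hρ' hb _).posDef]
  rw [heq]
  have hne : ∀ᶠ α : ℝ in nhdsWithin 1 {(1 : ℝ)}ᶜ, α - 1 ≠ 0 := by
    filter_upwards [self_mem_nhdsWithin] with α hα
    exact sub_ne_zero.2 hα
  refine aux_main_s8 hρ' hb ?_ ?_ ?_
  · have : Tendsto (fun α : ℝ => r * (α - 1)) (nhds 1) (nhds (r * (1 - 1))) :=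
      Continuous.tendsto (by fun_prop) 1
    simp only [sub_self, mul_zero] at this
    exact this.mono_left nhdsWithin_le_nhds
  · have : Tendsto (fun α : ℝ => α) (nhdsWithin 1 {(1 : ℝ)}ᶜ) (nhds 1) :=
      tendsto_id.mono_left nhdsWithin_le_nhds
    refine this.congr' ?_
    filter_upwards [hne] with α hα
    field_simp
  · filter_upwards [hne] with α hα
    exact mul_ne_zero hr hα

end MatrixTransfer

/-- As α → 1 (α ≠ 1), the matrix `(ρ^{α/(2r(α-1))} σ^{-1/r} ρ^{α/(2r(α-1))})^{r(α-1)}`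
converges to ρ. -/
theorem tendsto_inner_matrix {d : ℕ} (ρ σ : Matrix (Fin d) (Fin d) ℂ)
    (hρ : ρ.PosDef) (hσ : σ.PosDef) (r : ℝ) (hr : r ≠ 0) :
    Filter.Tendsto
      (fun α : ℝ => mpow
        (mpow ρ (α / (2 * r * (α - 1))) * mpow σ (-1 / r) * mpow ρ (α / (2 * r * (α - 1))))
        (r * (α - 1)))
      (nhdsWithin 1 {(1 : ℝ)}ᶜ) (nhds ρ) := by
  exact tendsto_aux ρ σ hρ hσ r hr
end

section
/- Let ρ and σ be positive definite d×d complex matrices and let r be a non-zero real number. Then lim_{α→1, α≠1} f_{α,r(α−1)}(ρ||σ) = lim_{α→1, α≠1} Tr((ρ^{α/(2r(α−1))} σ^{−1/r} ρ^{α/(2r(α−1))})^{r(α−1)}) = Tr ρ. -/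
open Matrix Filter
open scoped ComplexOrder

section aux
open scoped MatrixOrder Matrix.Norms.L2Operator

variable {n : Type*} [Fintype n] [DecidableEq n]

lemma aux_mpow_eq {A : Matrix n n ℂ} (hA : 0 ≤ A) (t : ℝ) : mpow A t = A ^ t := by
  have h : A.IsHermitian := (Matrix.nonneg_iff_posSemidef.1 hA).1
  rw [mpow, dif_pos h, ← h.cfc_eq, CFC.rpow_eq_cfc_real hA]

lemma aux_smul_rpow_s9 {A : Matrix n n ℂ} (hA : IsStrictlyPositive A) {c : ℝ} (hc : 0 < c) (z : ℝ) :
    (c • A) ^ z = c ^ z • A ^ z := by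
  have hA0 : 0 ≤ A := hA.nonneg
  have hsp : ∀ x ∈ spectrum ℝ A, 0 < x := fun x hx => hA.spectrum_pos hx
  have hcA : (0 : Matrix n n ℂ) ≤ c • A := smul_nonneg hc.le hA0
  have h1 : c • A = cfc (fun x : ℝ => c * x) A := by
    rw [cfc_const_mul c (fun x : ℝ => x) A, cfc_id' ℝ A]
  have hcont : ContinuousOn (fun x : ℝ => x ^ z) (spectrum ℝ A) := fun x hx =>
    (Real.continuousAt_rpow_const x z (Or.inl (hsp x hx).ne')).continuousWithinAt
  rw [CFC.rpow_eq_cfc_real hcA, CFC.rpow_eq_cfc_real hA0, ← cfc_const_mul _ _ A hcont]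
  have hcomp := cfc_comp' (fun x : ℝ => x ^ z) (fun x : ℝ => c * x) A (by
    rintro _ ⟨x, hx, rfl⟩
    exact (Real.continuousAt_rpow_const _ z
      (Or.inl (mul_pos hc (hsp x hx)).ne')).continuousWithinAt)
  rw [h1, ← hcomp]
  refine cfc_congr fun x hx => ?_
  exact Real.mul_rpow hc.le (hsp x hx).le

lemma aux_core {ρ τ : Matrix n n ℂ} (hρ : IsStrictlyPositive ρ) {s z : ℝ}
    (hs : s ≠ 0) (hz : 0 < z) (hz1 : z ≤ 1) {c e : ℝ} (hc : 0 < c) (he : 0 < e)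
    (h1 : c • (1 : Matrix n n ℂ) ≤ τ) (h2 : τ ≤ e • (1 : Matrix n n ℂ)) :
    c ^ z • ρ ^ (2 * s * z) ≤ (ρ ^ s * τ * ρ ^ s) ^ z ∧
      (ρ ^ s * τ * ρ ^ s) ^ z ≤ e ^ z • ρ ^ (2 * s * z) := by
  have hsq : ∀ k : ℝ, ρ ^ s * (k • (1 : Matrix n n ℂ)) * ρ ^ s = k • ρ ^ (2 * s) := by
    intro k
    rw [mul_smul_comm, smul_mul_assoc, mul_one, ← CFC.rpow_add hρ.isUnit, two_mul]
  have hp : ∀ k : ℝ, 0 < k → (k • ρ ^ (2 * s)) ^ z = k ^ z • ρ ^ (2 * s * z) := by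
    intro k hk
    rw [aux_smul_rpow_s9 (IsStrictlyPositive.rpow ρ _ hρ) hk,
      CFC.rpow_rpow ρ (2 * s) z (by simpa using hs) hρ]
  have hn : 0 ≤ ρ ^ s := CFC.rpow_nonneg
  constructor
  · rw [← hp c hc, ← hsq c]
    exact CFC.rpow_le_rpow ⟨hz.le, hz1⟩ (conjugate_le_conjugate_of_nonneg h1 hn)
  · rw [← hp e he, ← hsq e]
    exact CFC.rpow_le_rpow ⟨hz.le, hz1⟩ (conjugate_le_conjugate_of_nonneg h2 hn)

lemma aux_bounds_s9 {τ : Matrix n n ℂ} (hτ : IsStrictlyPositive τ) :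
    ∃ c : ℝ, 1 ≤ c ∧ c⁻¹ • (1 : Matrix n n ℂ) ≤ τ ∧ τ ≤ c • (1 : Matrix n n ℂ) := by
  rcases subsingleton_or_nontrivial (Matrix n n ℂ) with hsub | hnt
  · exact ⟨1, le_rfl, (Subsingleton.elim _ _).le, (Subsingleton.elim _ _).le⟩
  obtain ⟨m, hm, hm'⟩ := (CFC.exists_pos_algebraMap_le_iff (A := Matrix n n ℂ) (a := τ)
    (hτ.nonneg.isSelfAdjoint)).2 (fun x hx => hτ.spectrum_pos hx)
  have hM := IsSelfAdjoint.le_algebraMap_norm_self (a := τ) hτ.nonneg.isSelfAdjoint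
  rw [Algebra.algebraMap_eq_smul_one] at hm' hM
  have h01 : (0 : Matrix n n ℂ) ≤ 1 := zero_le_one
  refine ⟨max 1 (max m⁻¹ ‖τ‖), le_max_left _ _, le_trans ?_ hm', hM.trans ?_⟩
  · refine smul_le_smul_of_nonneg_right ?_ h01
    exact inv_le_of_inv_le₀ hm (le_max_of_le_right (le_max_left _ _))
  · refine smul_le_smul_of_nonneg_right ?_ h01
    exact le_max_of_le_right (le_max_right _ _)

lemma aux_inv {ρ τ : Matrix n n ℂ} (hρ : IsStrictlyPositive ρ) (hτ : IsStrictlyPositive τ)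
    (s z : ℝ) :
    (ρ ^ s * τ * ρ ^ s) ^ z = (ρ ^ (-s) * τ ^ (-1 : ℝ) * ρ ^ (-s)) ^ (-z) := by
  set u : (Matrix n n ℂ)ˣ := ⟨ρ ^ s * τ * ρ ^ s, ρ ^ (-s) * τ ^ (-1 : ℝ) * ρ ^ (-s), by
    have h1 := CFC.rpow_mul_rpow_neg s hρ
    have h2 : τ * τ ^ (-1 : ℝ) = 1 := by
      have := CFC.rpow_mul_rpow_neg 1 hτ
      rwa [CFC.rpow_one τ hτ.nonneg] at this
    calc _ = ρ ^ s * (τ * ((ρ ^ s * ρ ^ (-s)) * τ ^ (-1 : ℝ))) * ρ ^ (-s) := by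
          simp only [mul_assoc]
      _ = 1 := by rw [h1, one_mul, h2, mul_one, h1], by
    have h1 := CFC.rpow_neg_mul_rpow s hρ
    have h2 : τ ^ (-1 : ℝ) * τ = 1 := by
      have := CFC.rpow_neg_mul_rpow 1 hτ
      rwa [CFC.rpow_one τ hτ.nonneg] at this
    calc _ = ρ ^ (-s) * (τ ^ (-1 : ℝ) * ((ρ ^ (-s) * ρ ^ s) * τ)) * ρ ^ s := by
          simp only [mul_assoc]
      _ = 1 := by rw [h1, one_mul, h2, mul_one, h1]⟩ with hu
  have h0 : (0 : Matrix n n ℂ) ≤ u :=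
    conjugate_nonneg_of_nonneg hτ.nonneg (CFC.rpow_nonneg (a := ρ) (y := s))
  have := CFC.rpow_neg u (-z) h0
  rw [neg_neg] at this
  exact this

lemma aux_trace_mono {A B : Matrix n n ℂ} (h : A ≤ B) : A.trace.re ≤ B.trace.re := by
  have := (Matrix.le_iff.1 h).trace_nonneg
  rw [Matrix.trace_sub] at this
  have := (Complex.le_def.1 this).1
  simpa using this

lemma aux_trace_real {A : Matrix n n ℂ} (h : 0 ≤ A) : A.trace = (A.trace.re : ℂ) := by
  have := (Complex.le_def.1 (Matrix.nonneg_iff_posSemidef.1 h).trace_nonneg).2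
  apply Complex.ext <;> simp at *
  exact this.symm

lemma aux_trace_rpow_cont {A : Matrix n n ℂ} (hA : IsStrictlyPositive A) :
    Tendsto (fun α : ℝ => (A ^ α).trace.re) (nhds 1) (nhds A.trace.re) := by
  have hA0 := hA.nonneg
  have h : A.IsHermitian := (Matrix.nonneg_iff_posSemidef.1 hA0).1
  have key : ∀ α : ℝ, (A ^ α).trace = ∑ i, ((h.eigenvalues i ^ α : ℝ) : ℂ) := by
    intro α
    rw [CFC.rpow_eq_cfc_real hA0, h.cfc_eq, Matrix.IsHermitian.cfc,
      Unitary.conjStarAlgAut_apply, Matrix.trace_mul_comm, ← mul_assoc]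
    simp [Matrix.trace_diagonal]
  have key' : ∀ α : ℝ, (A ^ α).trace.re = ∑ i, h.eigenvalues i ^ α := by
    intro α
    rw [key, ← Complex.ofReal_sum, Complex.ofReal_re]
  have h1 : A.trace.re = ∑ i, h.eigenvalues i ^ (1 : ℝ) := by
    rw [← key', CFC.rpow_one A hA0]
  rw [h1]
  simp_rw [key']
  refine tendsto_finsetSum _ fun i _ => ?_
  exact (Real.continuousAt_const_rpow
    ((Matrix.isStrictlyPositive_iff_posDef.1 hA).eigenvalues_pos i).ne')

lemma aux_sandwich {ρ τ : Matrix n n ℂ} (hρ : IsStrictlyPositive ρ) (hτ : IsStrictlyPositive τ) :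
    ∃ c : ℝ, 0 < c ∧ ∀ s z : ℝ, s ≠ 0 → z ≠ 0 → |z| ≤ 1 →
      (c⁻¹) ^ |z| • ρ ^ (2 * s * z) ≤ (ρ ^ s * τ * ρ ^ s) ^ z ∧
        (ρ ^ s * τ * ρ ^ s) ^ z ≤ c ^ |z| • ρ ^ (2 * s * z) := by
  obtain ⟨c, hc, hc1, hc2⟩ := aux_bounds_s9 hτ
  obtain ⟨e, he, he1, he2⟩ := aux_bounds_s9 (IsStrictlyPositive.rpow τ (-1) hτ)
  have h01 : (0 : Matrix n n ℂ) ≤ 1 := zero_le_one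
  have hm : 0 < max c e := lt_max_of_lt_left (by linarith)
  refine ⟨max c e, hm, fun s z hs hz hz1 => ?_⟩
  rcases lt_or_gt_of_ne hz with h | h
  · rw [abs_of_neg h] at *
    rw [aux_inv hρ hτ]
    have := aux_core (s := -s) (z := -z) hρ (neg_ne_zero.2 hs) (by linarith) hz1
      (inv_pos.2 hm) hm (le_trans (smul_le_smul_of_nonneg_right
        (inv_anti₀ (by linarith) (le_max_right c e)) h01) he1)
      (he2.trans (smul_le_smul_of_nonneg_right (le_max_right c e) h01))
    rwa [show 2 * -s * -z = 2 * s * z by ring] at this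
  · rw [abs_of_pos h] at *
    exact aux_core hρ hs h hz1
      (inv_pos.2 hm) hm (le_trans (smul_le_smul_of_nonneg_right
        (inv_anti₀ (by linarith) (le_max_left c e)) h01) hc1)
      (hc2.trans (smul_le_smul_of_nonneg_right (le_max_left c e) h01))

lemma aux_main_s9 {d : ℕ} (ρ σ : Matrix (Fin d) (Fin d) ℂ)
    (hρ : ρ.PosDef) (hσ : σ.PosDef) (r : ℝ) (hr : r ≠ 0) :
    Filter.Tendsto
      (fun α : ℝ => Matrix.trace (mpow
        (mpow ρ (α / (2 * r * (α - 1))) * mpow σ (-1 / r) * mpow ρ (α / (2 * r * (α - 1))))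
        (r * (α - 1))))
      (nhdsWithin 1 {(1 : ℝ)}ᶜ) (nhds (Matrix.trace ρ)) := by
  have hρ' : IsStrictlyPositive ρ := Matrix.isStrictlyPositive_iff_posDef.2 hρ
  have hσ' : IsStrictlyPositive σ := Matrix.isStrictlyPositive_iff_posDef.2 hσ
  have hτ : IsStrictlyPositive (σ ^ (-1 / r)) := IsStrictlyPositive.rpow σ _ hσ'
  obtain ⟨c, hc, H⟩ := aux_sandwich hρ' hτ
  have heq : ∀ α : ℝ, mpow
        (mpow ρ (α / (2 * r * (α - 1))) * mpow σ (-1 / r) * mpow ρ (α / (2 * r * (α - 1))))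
        (r * (α - 1)) = (ρ ^ (α / (2 * r * (α - 1))) * σ ^ (-1 / r) *
          ρ ^ (α / (2 * r * (α - 1)))) ^ (r * (α - 1)) := by
    intro α
    rw [aux_mpow_eq hρ'.nonneg, aux_mpow_eq hσ'.nonneg, aux_mpow_eq]
    exact conjugate_nonneg_of_nonneg hτ.nonneg CFC.rpow_nonneg
  simp_rw [heq]
  have hreal : ∀ α : ℝ, ((ρ ^ (α / (2 * r * (α - 1))) * σ ^ (-1 / r) *
          ρ ^ (α / (2 * r * (α - 1)))) ^ (r * (α - 1))).trace =
      ((((ρ ^ (α / (2 * r * (α - 1))) * σ ^ (-1 / r) *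
          ρ ^ (α / (2 * r * (α - 1)))) ^ (r * (α - 1))).trace.re : ℝ) : ℂ) :=
    fun α => aux_trace_real CFC.rpow_nonneg
  rw [aux_trace_real hρ'.nonneg]
  refine Tendsto.congr (fun α => (hreal α).symm) ?_
  refine (Complex.continuous_ofReal.tendsto _).comp ?_
  have hlim : ∀ k : ℝ, 0 < k → Tendsto (fun α : ℝ => k ^ |r * (α - 1)| * (ρ ^ α).trace.re)
      (nhdsWithin 1 {(1 : ℝ)}ᶜ) (nhds ρ.trace.re) := by
    intro k hk
    have h1 : Tendsto (fun α : ℝ => k ^ |r * (α - 1)|) (nhds 1) (nhds 1) := by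
      have hcont : Continuous (fun α : ℝ => k ^ |r * (α - 1)|) :=
        Continuous.rpow continuous_const (by fun_prop) (fun _ => Or.inl hk.ne')
      simpa using hcont.tendsto 1
    have h2 := h1.mul (aux_trace_rpow_cont hρ')
    rw [one_mul] at h2
    exact h2.mono_left nhdsWithin_le_nhds
  have hev : ∀ᶠ α : ℝ in nhdsWithin 1 {(1 : ℝ)}ᶜ, α ≠ 1 ∧ α ≠ 0 ∧ |r * (α - 1)| ≤ 1 := by
    have e1 : ∀ᶠ α : ℝ in nhdsWithin 1 {(1 : ℝ)}ᶜ, α ≠ 1 := eventually_mem_nhdsWithin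
    have e2 : ∀ᶠ α : ℝ in nhds (1 : ℝ), α ≠ 0 := eventually_ne_nhds one_ne_zero
    have e3 : ∀ᶠ α : ℝ in nhds (1 : ℝ), |r * (α - 1)| < 1 := by
      have hcont : Continuous (fun α : ℝ => |r * (α - 1)|) := by fun_prop
      exact hcont.continuousAt.eventually_lt_const (by simp)
    filter_upwards [e1, nhdsWithin_le_nhds e2, nhdsWithin_le_nhds e3] with α a b c
    exact ⟨a, b, c.le⟩
  have hsand : ∀ α : ℝ, (α ≠ 1 ∧ α ≠ 0 ∧ |r * (α - 1)| ≤ 1) →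
      ((c⁻¹) ^ |r * (α - 1)| • ρ ^ α).trace.re ≤ ((ρ ^ (α / (2 * r * (α - 1))) * σ ^ (-1 / r) *
          ρ ^ (α / (2 * r * (α - 1)))) ^ (r * (α - 1))).trace.re ∧
      ((ρ ^ (α / (2 * r * (α - 1))) * σ ^ (-1 / r) *
          ρ ^ (α / (2 * r * (α - 1)))) ^ (r * (α - 1))).trace.re ≤
        (c ^ |r * (α - 1)| • ρ ^ α).trace.re := fun α h => by
    have hne : α - 1 ≠ 0 := sub_ne_zero.2 h.1
    have := H (α / (2 * r * (α - 1))) (r * (α - 1))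
      (div_ne_zero h.2.1 (mul_ne_zero (mul_ne_zero two_ne_zero hr) hne))
      (mul_ne_zero hr hne) h.2.2
    rw [show 2 * (α / (2 * r * (α - 1))) * (r * (α - 1)) = α by field_simp] at this
    exact And.intro (aux_trace_mono this.1) (aux_trace_mono this.2)
  refine tendsto_of_tendsto_of_tendsto_of_le_of_le' (hlim c⁻¹ (inv_pos.2 hc)) (hlim c hc) ?_ ?_
  · filter_upwards [hev] with α h
    have := (hsand α h).1
    simpa [Matrix.trace_smul] using this
  · filter_upwards [hev] with α h
    have := (hsand α h).2
    simpa [Matrix.trace_smul] using this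

end aux

/-- As α → 1 (α ≠ 1), the trace functional `f_{α,r(α-1)}(ρ‖σ)
= Tr((ρ^{α/(2r(α-1))} σ^{-1/r} ρ^{α/(2r(α-1))})^{r(α-1)})` converges to `Tr ρ`. -/
theorem tendsto_traceFun_one {d : ℕ} (ρ σ : Matrix (Fin d) (Fin d) ℂ)
    (hρ : ρ.PosDef) (hσ : σ.PosDef) (r : ℝ) (hr : r ≠ 0) :
    Filter.Tendsto
      (fun α : ℝ => Matrix.trace (mpow
        (mpow ρ (α / (2 * r * (α - 1))) * mpow σ (-1 / r) * mpow ρ (α / (2 * r * (α - 1))))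
        (r * (α - 1))))
      (nhdsWithin 1 {(1 : ℝ)}ᶜ) (nhds (Matrix.trace ρ)) := by
  exact aux_main_s9 ρ σ hρ hσ r hr
end

section
/- Let A be a positive semidefinite d×d complex matrix whose largest eigenvalue μ₁ is simple, i.e. μ₁ > μ₂ where μ₁ ≥ μ₂ ≥ … ≥ μ_d are the eigenvalues of A in decreasing order, let u₁ be a unit eigenvector of A for μ₁, let B be a positive definite d×d complex matrix, set B₁₁ := ⟨u₁, B u₁⟩ > 0, and let β > 0. Then μ₁^{2β} · B₁₁ ≤ λ₁(A^β B A^β) ≤ μ₁^{2β} · B₁₁ + μ₂^{2β} · λ₁(B), where λ₁(X) denotes the largest eigenvalue of a positive semidefinite matrix X. -/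
open Matrix Filter
open scoped ComplexOrder

/-- The largest eigenvalue of a Hermitian matrix (junk value 0 otherwise). -/
noncomputable def lamMax {n : Type*} [Fintype n] [DecidableEq n] (A : Matrix n n ℂ) : ℝ :=
  if hA : A.IsHermitian then sSup (Set.range hA.eigenvalues) else 0


lemma aux_quad {n : Type*} [Fintype n] [DecidableEq n] (U : Matrix n n ℂ) (g : n → ℝ) (x : n → ℂ) :
    star x ⬝ᵥ ((U * diagonal (fun i => (g i : ℂ)) * Uᴴ) *ᵥ x) =
      ((∑ i, g i * Complex.normSq ((Uᴴ *ᵥ x) i) : ℝ) : ℂ) := by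
  have h1 : star x ⬝ᵥ ((U * diagonal (fun i => (g i : ℂ)) * Uᴴ) *ᵥ x) =
      star (Uᴴ *ᵥ x) ⬝ᵥ (diagonal (fun i => (g i : ℂ)) *ᵥ (Uᴴ *ᵥ x)) := by
    rw [star_mulVec, conjTranspose_conjTranspose, ← dotProduct_mulVec]
    simp only [mulVec_mulVec, Matrix.mul_assoc]
  rw [h1]
  simp only [dotProduct, mulVec_diagonal, Pi.star_apply, Complex.ofReal_sum, Complex.ofReal_mul]
  refine Finset.sum_congr rfl fun i _ => ?_
  rw [Complex.normSq_eq_conj_mul_self, starRingEnd_apply]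
  ring

lemma aux_spec {n : Type*} [Fintype n] [DecidableEq n] {M : Matrix n n ℂ} (hM : M.IsHermitian) :
    M = (hM.eigenvectorUnitary : Matrix n n ℂ) * diagonal (fun i => (hM.eigenvalues i : ℂ)) *
      (hM.eigenvectorUnitary : Matrix n n ℂ)ᴴ := by
  conv_lhs => rw [hM.spectral_theorem, Unitary.conjStarAlgAut_apply]
  rfl

lemma aux_UU {n : Type*} [Fintype n] [DecidableEq n] {M : Matrix n n ℂ} (hM : M.IsHermitian) :
    (hM.eigenvectorUnitary : Matrix n n ℂ)ᴴ * (hM.eigenvectorUnitary : Matrix n n ℂ) = 1 :=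
  Unitary.coe_star_mul_self hM.eigenvectorUnitary

lemma aux_UU' {n : Type*} [Fintype n] [DecidableEq n] {M : Matrix n n ℂ} (hM : M.IsHermitian) :
    (hM.eigenvectorUnitary : Matrix n n ℂ) * (hM.eigenvectorUnitary : Matrix n n ℂ)ᴴ = 1 :=
  Unitary.coe_mul_star_self hM.eigenvectorUnitary

lemma aux_dd {n : Type*} [Fintype n] [DecidableEq n] (U : Matrix n n ℂ) (hU : Uᴴ * U = 1)
    (g h : n → ℝ) :
    (U * diagonal (fun i => (g i : ℂ)) * Uᴴ) * (U * diagonal (fun i => (h i : ℂ)) * Uᴴ) =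
      U * diagonal (fun i => ((g i * h i : ℝ) : ℂ)) * Uᴴ := by
  have : (U * diagonal (fun i => (g i : ℂ)) * Uᴴ) * (U * diagonal (fun i => (h i : ℂ)) * Uᴴ) =
      U * diagonal (fun i => (g i : ℂ)) * (Uᴴ * U) * diagonal (fun i => (h i : ℂ)) * Uᴴ := by
    simp only [Matrix.mul_assoc]
  rw [this, hU, Matrix.mul_one, Matrix.mul_assoc U, diagonal_mul_diagonal]
  simp

lemma aux_norm {n : Type*} [Fintype n] [DecidableEq n] (U : Matrix n n ℂ) (hU : U * Uᴴ = 1)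
    (x : n → ℂ) : star x ⬝ᵥ x = ((∑ i, Complex.normSq ((Uᴴ *ᵥ x) i) : ℝ) : ℂ) := by
  have := aux_quad U (fun _ => 1) x
  simpa [hU] using this

lemma aux_le {n : Type*} [Fintype n] [DecidableEq n] {M : Matrix n n ℂ} (hM : M.IsHermitian)
    (i : n) : hM.eigenvalues i ≤ lamMax M := by
  rw [lamMax, dif_pos hM]
  exact le_csSup (Set.finite_range _).bddAbove ⟨i, rfl⟩

lemma aux_ex {n : Type*} [Fintype n] [DecidableEq n] [Nonempty n] {M : Matrix n n ℂ}
    (hM : M.IsHermitian) : ∃ i, hM.eigenvalues i = lamMax M := by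
  rw [lamMax, dif_pos hM]
  exact (Set.range_nonempty _).csSup_mem (Set.finite_range _)

lemma aux_ray {n : Type*} [Fintype n] [DecidableEq n] {M : Matrix n n ℂ} (hM : M.IsHermitian)
    (x : n → ℂ) : (star x ⬝ᵥ (M *ᵥ x)).re ≤ lamMax M * (star x ⬝ᵥ x).re := by
  rw [aux_norm _ (aux_UU' hM) x]
  conv_lhs => rw [aux_spec hM]
  rw [aux_quad, Complex.ofReal_re, Complex.ofReal_re, Finset.mul_sum]
  exact Finset.sum_le_sum fun i _ =>
    mul_le_mul_of_nonneg_right (aux_le hM i) (Complex.normSq_nonneg _)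

lemma aux_sq {n : Type*} [Fintype n] [DecidableEq n] {M : Matrix n n ℂ} (hM : M.PosSemidef)
    (x : n → ℂ) : (star (M *ᵥ x) ⬝ᵥ (M *ᵥ x)).re ≤ lamMax M * (star x ⬝ᵥ (M *ᵥ x)).re := by
  have h0 : star (M *ᵥ x) ⬝ᵥ (M *ᵥ x) = star x ⬝ᵥ ((M * M) *ᵥ x) := by
    rw [star_mulVec, ← dotProduct_mulVec, hM.1.eq, mulVec_mulVec]
  have h1 := aux_dd _ (aux_UU hM.1) hM.1.eigenvalues hM.1.eigenvalues
  rw [← aux_spec hM.1] at h1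
  rw [h0, h1, aux_quad]
  have h2 := aux_quad (hM.1.eigenvectorUnitary : Matrix n n ℂ) hM.1.eigenvalues x
  rw [← aux_spec hM.1] at h2
  rw [h2, Complex.ofReal_re, Complex.ofReal_re, Finset.mul_sum]
  refine Finset.sum_le_sum fun i _ => ?_
  rw [← mul_assoc]
  exact mul_le_mul_of_nonneg_right
    (mul_le_mul_of_nonneg_right (aux_le hM.1 i) (hM.eigenvalues_nonneg i)) (Complex.normSq_nonneg _)

lemma aux_cs {n : Type*} [Fintype n] [DecidableEq n] {M : Matrix n n ℂ} (hM : M.PosSemidef)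
    (u x : n → ℂ) : Complex.normSq (star u ⬝ᵥ (M *ᵥ x)) ≤
      (star u ⬝ᵥ (M *ᵥ u)).re * (star x ⬝ᵥ (M *ᵥ x)).re := by
  obtain ⟨E, rfl⟩ : ∃ E : Matrix n n ℂ, M = Eᴴ * E := by
    open scoped MatrixOrder in
    exact CStarAlgebra.nonneg_iff_eq_star_mul_self.mp hM.nonneg
  have h (a b : n → ℂ) : star a ⬝ᵥ ((Eᴴ * E) *ᵥ b) =
      inner ℂ (WithLp.toLp 2 (E *ᵥ a)) (WithLp.toLp 2 (E *ᵥ b)) := by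
    rw [EuclideanSpace.inner_toLp_toLp, dotProduct_comm (E *ᵥ b), star_mulVec, ← dotProduct_mulVec,
      mulVec_mulVec]
  rw [h, h, h, Complex.normSq_eq_norm_sq, sq]
  have := inner_mul_inner_self_le (𝕜 := ℂ) (WithLp.toLp 2 (E *ᵥ u)) (WithLp.toLp 2 (E *ᵥ x))
  rwa [norm_inner_symm (WithLp.toLp 2 (E *ᵥ x))] at this

theorem approximation_lemma {d : ℕ} (A B : Matrix (Fin d) (Fin d) ℂ)
    (hA : A.PosSemidef) (hB : B.PosDef)
    (μ₁ μ₂ : ℝ) (i₁ : Fin d)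
    (hμ₁ : hA.1.eigenvalues i₁ = μ₁)
    (hsec : ∀ j, j ≠ i₁ → hA.1.eigenvalues j ≤ μ₂)
    (hsec' : ∃ j, j ≠ i₁ ∧ hA.1.eigenvalues j = μ₂)
    (hgap : μ₂ < μ₁)
    (u₁ : Fin d → ℂ) (hunit : star u₁ ⬝ᵥ u₁ = 1)
    (heig : A.mulVec u₁ = (μ₁ : ℂ) • u₁)
    (B₁₁ : ℝ) (hB₁₁ : star u₁ ⬝ᵥ B.mulVec u₁ = (B₁₁ : ℂ))
    (β : ℝ) (hβ : 0 < β) :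
    μ₁ ^ (2 * β) * B₁₁ ≤ lamMax (mpow A β * B * mpow A β) ∧
      lamMax (mpow A β * B * mpow A β) ≤ μ₁ ^ (2 * β) * B₁₁ + μ₂ ^ (2 * β) * lamMax B := by
  have : Nonempty (Fin d) := ⟨i₁⟩
  have hμ₂0 : 0 ≤ μ₂ := by
    obtain ⟨j, _, hj⟩ := hsec'
    rw [← hj]; exact hA.eigenvalues_nonneg j
  have hμ₁0 : 0 ≤ μ₁ := hμ₂0.trans hgap.le
  have hsq (x : ℝ) (hx : 0 ≤ x) : x ^ β * x ^ β = x ^ (2 * β) := by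
    rw [two_mul, Real.rpow_add_of_nonneg hx hβ.le hβ.le]
  have hUU := aux_UU hA.1
  have hUU' := aux_UU' hA.1
  have hspec := aux_spec hA.1
  have hP : mpow A β = (hA.1.eigenvectorUnitary : Matrix (Fin d) (Fin d) ℂ) *
      diagonal (fun i => ((hA.1.eigenvalues i ^ β : ℝ) : ℂ)) *
      (hA.1.eigenvectorUnitary : Matrix (Fin d) (Fin d) ℂ)ᴴ := by
    rw [mpow, dif_pos hA.1, Matrix.IsHermitian.cfc, Unitary.conjStarAlgAut_apply]
    rfl
  set U : Matrix (Fin d) (Fin d) ℂ := (hA.1.eigenvectorUnitary : Matrix (Fin d) (Fin d) ℂ) with hU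
  set P := mpow A β with hPdef
  have hPH : Pᴴ = P := by
    rw [hP]
    simp only [conjTranspose_mul, conjTranspose_conjTranspose, diagonal_conjTranspose,
      Matrix.mul_assoc]
    congr 3
    ext i
    simp
  have hPP := aux_dd U hUU (fun i => hA.1.eigenvalues i ^ β) (fun i => hA.1.eigenvalues i ^ β)
  rw [← hP] at hPP
  simp only [fun i => hsq _ (hA.eigenvalues_nonneg i)] at hPP
  -- coordinates of u₁
  set p := Uᴴ *ᵥ u₁ with hp
  have hup : u₁ = U *ᵥ p := by rw [hp, mulVec_mulVec, hUU', one_mulVec]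
  have hp0 : ∀ j, j ≠ i₁ → p j = 0 := by
    intro j hj
    have h1 : Uᴴ *ᵥ (A *ᵥ u₁) = (μ₁ : ℂ) • p := by rw [heig, mulVec_smul]
    have h2 : Uᴴ *ᵥ (A *ᵥ u₁) = diagonal (fun i => (hA.1.eigenvalues i : ℂ)) *ᵥ p := by
      have : Uᴴ * A = diagonal (fun i => (hA.1.eigenvalues i : ℂ)) * Uᴴ := by
        conv_lhs => rw [hspec]
        rw [← Matrix.mul_assoc, ← Matrix.mul_assoc, hUU, Matrix.one_mul]
      rw [mulVec_mulVec, this, ← mulVec_mulVec]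
    have h3 := congrFun (h2.symm.trans h1) j
    rw [mulVec_diagonal, Pi.smul_apply, smul_eq_mul, ← sub_eq_zero, ← sub_mul] at h3
    rcases mul_eq_zero.mp h3 with h | h
    · exfalso
      have : hA.1.eigenvalues j = μ₁ := by exact_mod_cast sub_eq_zero.mp h
      linarith [hsec j hj]
    · exact h
  have hp1 : Complex.normSq (p i₁) = 1 := by
    have h := aux_norm U hUU' u₁
    rw [hunit, Finset.sum_eq_single i₁ (fun j _ hj => by rw [← hp, hp0 j hj, map_zero]) (by simp)] at h
    exact_mod_cast h.symm
  have hPu : P *ᵥ u₁ = ((μ₁ ^ β : ℝ) : ℂ) • u₁ := by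
    have : P *ᵥ u₁ = U *ᵥ (diagonal (fun i => ((hA.1.eigenvalues i ^ β : ℝ) : ℂ)) *ᵥ p) := by
      rw [hP, hp]; simp only [mulVec_mulVec, Matrix.mul_assoc]
    rw [this]
    have h2 : diagonal (fun i => ((hA.1.eigenvalues i ^ β : ℝ) : ℂ)) *ᵥ p
        = ((μ₁ ^ β : ℝ) : ℂ) • p := by
      ext j
      rw [mulVec_diagonal, Pi.smul_apply, smul_eq_mul]
      by_cases hj : j = i₁
      · rw [hj, hμ₁]
      · rw [hp0 j hj]; simp
    rw [h2, mulVec_smul, ← hup]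
  have hC : (P * B * P).IsHermitian := by
    rw [Matrix.IsHermitian, conjTranspose_mul, conjTranspose_mul, hPH, hB.1.eq, Matrix.mul_assoc]
  have hB0 : 0 ≤ B₁₁ := by
    have := hB.posSemidef.re_dotProduct_nonneg u₁
    rw [hB₁₁] at this
    simpa using this
  have hlB : 0 ≤ lamMax B :=
    (hB.posSemidef.eigenvalues_nonneg i₁).trans (aux_le hB.1 i₁)
  have hCq (x : Fin d → ℂ) : star x ⬝ᵥ ((P * B * P) *ᵥ x) = star (P *ᵥ x) ⬝ᵥ (B *ᵥ (P *ᵥ x)) := by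
    rw [star_mulVec, hPH, ← dotProduct_mulVec]
    simp only [mulVec_mulVec, Matrix.mul_assoc]
  constructor
  · have h := aux_ray hC u₁
    rw [hCq, hunit, hPu, mulVec_smul, star_smul, smul_dotProduct, dotProduct_smul, hB₁₁] at h
    rw [← hsq _ hμ₁0]
    simpa [mul_assoc] using h
  · obtain ⟨k, hk⟩ := aux_ex hC
    set l := lamMax (P * B * P) with hl
    obtain ⟨v, hv0, hv⟩ : ∃ v : Fin d → ℂ, v ≠ 0 ∧ (P * B * P) *ᵥ v = (l : ℂ) • v := by
      refine ⟨⇑(hC.eigenvectorBasis k), ?_, ?_⟩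
      · intro h
        have := hC.eigenvectorBasis.orthonormal.ne_zero k
        apply this
        ext i
        exact congrFun h i
      · rw [hC.mulVec_eigenvectorBasis, hk]
        ext i; simp
    set w := P *ᵥ v with hw
    have hPBw : P *ᵥ (B *ᵥ w) = (l : ℂ) • v := by
      rw [← hv, hw]; simp only [mulVec_mulVec, Matrix.mul_assoc]
    have hR : 0 ≤ μ₁ ^ (2 * β) * B₁₁ + μ₂ ^ (2 * β) * lamMax B := by positivity
    by_cases hw0 : w = 0
    · rw [hw0, mulVec_zero, mulVec_zero] at hPBw
      rcases smul_eq_zero.mp hPBw.symm with h | h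
      · have : l = 0 := by exact_mod_cast h
        rw [this]; exact hR
      · exact absurd h hv0
    · have hpos : 0 < (star w ⬝ᵥ (B *ᵥ w)).re := hB.re_dotProduct_pos hw0
      set z := B *ᵥ w with hz
      have hzPz : star z ⬝ᵥ ((P * P) *ᵥ z) = (l : ℂ) * (star w ⬝ᵥ z) := by
        rw [← mulVec_mulVec, hPBw, mulVec_smul, ← hw, dotProduct_smul, smul_eq_mul, hz, star_mulVec,
          hB.1.eq, ← dotProduct_mulVec]
      have hq : l * (star w ⬝ᵥ z).re =
          ∑ i, hA.1.eigenvalues i ^ (2 * β) * Complex.normSq ((Uᴴ *ᵥ z) i) := by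
        rw [hPP, aux_quad] at hzPz
        have := congrArg Complex.re hzPz
        rw [Complex.ofReal_re, Complex.re_ofReal_mul] at this
        exact this.symm
      have hzn : (star z ⬝ᵥ z).re = ∑ i, Complex.normSq ((Uᴴ *ᵥ z) i) := by
        rw [aux_norm U hUU' z, Complex.ofReal_re]
      have huz : Complex.normSq (star u₁ ⬝ᵥ z) = Complex.normSq ((Uᴴ *ᵥ z) i₁) := by
        have : star u₁ ⬝ᵥ z = star (p i₁) * (Uᴴ *ᵥ z) i₁ := by
          rw [hup, star_mulVec, ← dotProduct_mulVec, dotProduct,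
            Finset.sum_eq_single i₁ (fun j _ hj => by simp [hp0 j hj]) (by simp)]
          rfl
        rw [this, Complex.normSq_mul, ← starRingEnd_apply, Complex.normSq_conj, hp1, one_mul]
      have hcs := aux_cs hB.posSemidef u₁ w
      rw [← hz, huz, hB₁₁, Complex.ofReal_re] at hcs
      have hs := aux_sq hB.posSemidef w
      rw [← hz, hzn] at hs
      have hbound : ∑ i, hA.1.eigenvalues i ^ (2 * β) * Complex.normSq ((Uᴴ *ᵥ z) i) ≤
          μ₁ ^ (2 * β) * Complex.normSq ((Uᴴ *ᵥ z) i₁) +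
            μ₂ ^ (2 * β) * ∑ i, Complex.normSq ((Uᴴ *ᵥ z) i) := by
        rw [← Finset.add_sum_erase _ _ (Finset.mem_univ i₁), hμ₁, Finset.mul_sum]
        gcongr
        refine (Finset.sum_le_sum fun i hi => ?_).trans
          (Finset.sum_le_sum_of_subset_of_nonneg (Finset.erase_subset i₁ Finset.univ)
            fun i _ _ => mul_nonneg (Real.rpow_nonneg hμ₂0 _) (Complex.normSq_nonneg _))
        exact mul_le_mul_of_nonneg_right
          (Real.rpow_le_rpow (hA.eigenvalues_nonneg i) (hsec i (Finset.ne_of_mem_erase hi))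
            (by positivity)) (Complex.normSq_nonneg _)
      have h1 := mul_le_mul_of_nonneg_left hcs (Real.rpow_nonneg hμ₁0 (2 * β))
      have h2 := mul_le_mul_of_nonneg_left hs (Real.rpow_nonneg hμ₂0 (2 * β))
      refine le_of_mul_le_mul_right ?_ hpos
      rw [hq]
      linarith
end

section
/- Let ρ be a positive semidefinite d×d complex matrix with ρ ≠ 0 and largest eigenvalue at most 1, let σ be a positive definite d×d complex matrix, let Π be the orthogonal projection onto the range of ρ, and suppose ρσ = σρ. Then lim_{α→0⁺} f_{α,α}(ρ||σ) = lim_{α→0⁺} Tr((σ^{(1−α)/(2α)} ρ σ^{(1−α)/(2α)})^α) = Tr(Π σ). -/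
open Matrix Filter
open scoped ComplexOrder

lemma cfc_mulVec_of_eigen {n : Type*} [Fintype n] [DecidableEq n] {A : Matrix n n ℂ}
    (hA : A.IsHermitian) (f : ℝ → ℝ) (v : n → ℂ) (m : ℝ) (hv : A *ᵥ v = (m : ℂ) • v) :
    hA.cfc f *ᵥ v = (f m : ℂ) • v := by
  set U : Matrix n n ℂ := (hA.eigenvectorUnitary : Matrix n n ℂ) with hU
  have hUU : star U * U = 1 := Unitary.coe_star_mul_self hA.eigenvectorUnitary
  have hUU' : U * star U = 1 := Unitary.coe_mul_star_self hA.eigenvectorUnitary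
  have hspec : A = U * diagonal (RCLike.ofReal ∘ hA.eigenvalues) * star U := by
    conv_lhs => rw [hA.spectral_theorem, Unitary.conjStarAlgAut_apply]
  have hcfc : hA.cfc f = U * diagonal (RCLike.ofReal ∘ f ∘ hA.eigenvalues) * star U := by
    rw [Matrix.IsHermitian.cfc, Unitary.conjStarAlgAut_apply]
  set w := star U *ᵥ v with hw
  have hvw : v = U *ᵥ w := by rw [hw, mulVec_mulVec, hUU', one_mulVec]
  have h1 : diagonal (RCLike.ofReal ∘ hA.eigenvalues) *ᵥ w = (m : ℂ) • w := by
    have h2 : star U *ᵥ (A *ᵥ v) = (m : ℂ) • w := by rw [hv, mulVec_smul]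
    rw [← h2, hw, mulVec_mulVec, mulVec_mulVec]
    congr 1
    conv_rhs => rw [hspec]
    rw [← mul_assoc, ← mul_assoc, hUU, one_mul]
  have h3 : diagonal (RCLike.ofReal ∘ f ∘ hA.eigenvalues) *ᵥ w = (f m : ℂ) • w := by
    funext i
    have := congrFun h1 i
    simp only [mulVec_diagonal, Pi.smul_apply, smul_eq_mul, Function.comp] at this ⊢
    by_cases h0 : w i = 0
    · simp [h0]
    · have h4 := mul_right_cancel₀ h0 this
      have h5 : hA.eigenvalues i = m := Complex.ofReal_injective h4
      rw [h5]; rfl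
  rw [hcfc, ← mulVec_mulVec, ← mulVec_mulVec, ← hw, h3, mulVec_smul, ← hvw]

lemma mpow_isHermitian {n : Type*} [Fintype n] [DecidableEq n] (A : Matrix n n ℂ) (t : ℝ) :
    (mpow A t).IsHermitian := by
  unfold mpow
  split_ifs with h
  · rw [← h.cfc_eq]
    exact cfc_predicate _ A
  · exact Matrix.isHermitian_zero

lemma mpow_mulVec {n : Type*} [Fintype n] [DecidableEq n] {A : Matrix n n ℂ}
    (hA : A.IsHermitian) (t : ℝ) (v : n → ℂ) (m : ℝ) (hv : A *ᵥ v = (m : ℂ) • v) :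
    mpow A t *ᵥ v = ((m ^ t : ℝ) : ℂ) • v := by
  unfold mpow
  rw [dif_pos hA]
  exact cfc_mulVec_of_eigen hA _ v m hv

lemma trace_of_eigenbasis {d : ℕ} {ι : Type*} [Fintype ι]
    (b : Module.Basis ι ℂ (Fin d → ℂ)) (A : Matrix (Fin d) (Fin d) ℂ) (l : ι → ℂ)
    (h : ∀ i, A *ᵥ b i = l i • b i) : A.trace = ∑ i, l i := by
  classical
  have h1 : A.trace = LinearMap.trace ℂ _ (Matrix.toLin' A) := by simp
  rw [h1, LinearMap.trace_eq_matrix_trace ℂ b, Matrix.trace]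
  refine Finset.sum_congr rfl fun i _ => ?_
  simp [LinearMap.toMatrix_apply, h]

lemma exists_joint_basis {d : ℕ} (ρ σ : Matrix (Fin d) (Fin d) ℂ)
    (hρ : ρ.IsHermitian) (hσ : σ.IsHermitian) (hcomm : ρ * σ = σ * ρ) :
    ∃ (ι : Type) (_ : Fintype ι) (b : Module.Basis ι ℂ (Fin d → ℂ)) (r s : ι → ℂ),
      (∀ i, ρ *ᵥ b i = r i • b i) ∧ (∀ i, σ *ᵥ b i = s i • b i) := by
  have hA := isSymmetric_toEuclideanLin_iff.mpr hρ
  have hB := isSymmetric_toEuclideanLin_iff.mpr hσ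
  have hAB : Commute ρ.toEuclideanLin σ.toEuclideanLin := by
    refine LinearMap.ext fun x => ?_
    simp only [Module.End.mul_apply, toLpLin_apply, mulVec_mulVec, hcomm]
  have hint := LinearMap.IsSymmetric.directSum_isInternal_of_commute hA hB hAB
  let b0 := hint.collectedBasis fun i => Module.finBasis ℂ _
  have hmem := fun a => hint.collectedBasis_mem (fun i => Module.finBasis ℂ _) a
  let b := b0.map (WithLp.linearEquiv 2 ℂ (Fin d → ℂ))
  refine ⟨_, FiniteDimensional.fintypeBasisIndex b, b, fun a => a.1.2, fun a => a.1.1, ?_, ?_⟩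
  · intro a
    have := Module.End.mem_eigenspace_iff.mp (Submodule.mem_inf.mp (hmem a)).1
    exact congrArg WithLp.ofLp this
  · intro a
    have := Module.End.mem_eigenspace_iff.mp (Submodule.mem_inf.mp (hmem a)).2
    exact congrArg WithLp.ofLp this

lemma scalar_limit (r s : ℝ) (hr : 0 ≤ r) (hs : 0 < s) :
    Tendsto (fun α : ℝ => (s ^ ((1 - α) / (2 * α)) * r * s ^ ((1 - α) / (2 * α))) ^ α)
      (nhdsWithin 0 (Set.Ioi 0)) (nhds (if r = 0 then 0 else s)) := by
  split_ifs with h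
  · refine tendsto_const_nhds.congr' ?_
    filter_upwards [self_mem_nhdsWithin] with α hα
    have : α ≠ 0 := ne_of_gt hα
    simp [h, Real.zero_rpow this]
  · have hr' : 0 < r := lt_of_le_of_ne hr (Ne.symm h)
    have hc : ContinuousAt (fun α : ℝ => r ^ α * s ^ (1 - α)) 0 := by
      refine ContinuousAt.mul ?_ ?_
      · exact ContinuousAt.rpow continuousAt_const continuousAt_id (Or.inl hr'.ne')
      · exact ContinuousAt.rpow continuousAt_const (by fun_prop) (Or.inl hs.ne')
    have h1 : Tendsto (fun α : ℝ => r ^ α * s ^ (1 - α)) (nhdsWithin 0 (Set.Ioi 0)) (nhds s) := by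
      have := hc.tendsto.mono_left (nhdsWithin_le_nhds (s := Set.Ioi 0))
      simpa using this
    refine h1.congr' ?_
    filter_upwards [self_mem_nhdsWithin] with α hα
    have hα0 : α ≠ 0 := ne_of_gt hα
    have e : s ^ ((1 - α) / (2 * α)) * r * s ^ ((1 - α) / (2 * α)) = r * s ^ ((1 - α) / α) := by
      have : (1 - α) / α = (1 - α) / (2 * α) + (1 - α) / (2 * α) := by field_simp; ring
      rw [this, Real.rpow_add hs]; ring
    rw [e, Real.mul_rpow hr (Real.rpow_nonneg hs.le _), ← Real.rpow_mul hs.le,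
      div_mul_cancel₀ _ hα0]

/-- For ρ ≠ 0 positive semidefinite with largest eigenvalue at most 1 and σ positive
definite, if ρ and σ commute and P is the orthogonal projection onto the range of ρ, then
`lim_{α→0⁺} f_{α,α}(ρ‖σ) = lim_{α→0⁺} Tr((σ^{(1-α)/2α} ρ σ^{(1-α)/2α})^α) = Tr(P σ)`. -/
theorem limit_alpha_zero {d : ℕ} (ρ σ P : Matrix (Fin d) (Fin d) ℂ)
    (hρ : ρ.PosSemidef) (hρ0 : ρ ≠ 0) (hρ1 : lamMax ρ ≤ 1) (hσ : σ.PosDef)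
    (hcomm : ρ * σ = σ * ρ)
    (hP : P.IsHermitian) (hP2 : P * P = P)
    (hPrange : LinearMap.range P.mulVecLin = LinearMap.range ρ.mulVecLin) :
    Filter.Tendsto
      (fun α : ℝ => Matrix.trace
        (mpow (mpow σ ((1 - α) / (2 * α)) * ρ * mpow σ ((1 - α) / (2 * α))) α))
      (nhdsWithin 0 (Set.Ioi 0)) (nhds (Matrix.trace (P * σ))) := by
  obtain ⟨ι, _, b, r, s, hr, hs⟩ := exists_joint_basis ρ σ hρ.1 hσ.1 hcomm
  have hb : ∀ i, b i ≠ 0 := fun i => b.ne_zero i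
  have hc : ∀ i, 0 < star (b i) ⬝ᵥ b i := fun i => dotProduct_star_self_pos_iff.mpr (hb i)
  have hr0 : ∀ i, 0 ≤ r i := fun i => by
    have h := hρ.dotProduct_mulVec_nonneg (b i)
    rw [hr, dotProduct_smul, smul_eq_mul] at h
    exact le_of_mul_le_mul_right (by simpa using h) (hc i)
  have hs0 : ∀ i, 0 < s i := fun i => by
    have h := hσ.dotProduct_mulVec_pos (hb i)
    rw [hs, dotProduct_smul, smul_eq_mul] at h
    exact lt_of_mul_lt_mul_right (by simpa using h) (hc i).le
  have hr1 : ∀ i, r i = ((r i).re : ℂ) := fun i => Complex.eq_re_of_ofReal_le (r := 0) (by simpa using hr0 i)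
  have hs1 : ∀ i, s i = ((s i).re : ℂ) := fun i => Complex.eq_re_of_ofReal_le (r := 0) (by simpa using (hs0 i).le)
  have hr2 : ∀ i, 0 ≤ (r i).re := fun i => (Complex.le_def.mp (hr0 i)).1
  have hs2 : ∀ i, 0 < (s i).re := fun i => (Complex.lt_def.mp (hs0 i)).1
  have hPb : ∀ i, P *ᵥ b i = (if (r i).re = 0 then (0 : ℂ) else 1) • b i := by
    intro i
    split_ifs with h
    · have hρb : ρ *ᵥ b i = 0 := by rw [hr, hr1, h]; simp
      have hmem : P *ᵥ b i ∈ LinearMap.range ρ.mulVecLin := by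
        rw [← hPrange]; exact ⟨b i, rfl⟩
      obtain ⟨w, hw⟩ := hmem
      rw [mulVecLin_apply] at hw
      rw [zero_smul, ← dotProduct_star_self_eq_zero]
      have e1 : star (P *ᵥ b i) ⬝ᵥ (P *ᵥ b i) = star (b i) ⬝ᵥ (P *ᵥ b i) := by
        rw [star_mulVec, hP.eq, ← dotProduct_mulVec, mulVec_mulVec, hP2]
      have e2 : star (b i) ⬝ᵥ (ρ *ᵥ w) = 0 := by
        rw [dotProduct_mulVec]
        have : star (b i) ᵥ* ρ = 0 := by
          have := star_mulVec ρ (b i)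
          rw [hρ.1.eq, hρb] at this
          rw [← this]; simp
        rw [this, zero_dotProduct]
      first
        | rw [e1, ← hw, e2]
        | rw [dotProduct_comm, e1, ← hw, e2]
    · have hri : r i ≠ 0 := fun h0 => h (by simp [h0])
      have hmem : b i ∈ LinearMap.range P.mulVecLin := by
        rw [hPrange]
        refine ⟨(r i)⁻¹ • b i, ?_⟩
        rw [mulVecLin_apply, mulVec_smul, hr, smul_smul, inv_mul_cancel₀ hri, one_smul]
      obtain ⟨w, hw⟩ := hmem
      rw [mulVecLin_apply] at hw
      rw [one_smul, ← hw, mulVec_mulVec, hP2]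
  have hR : (P * σ).trace = ∑ i, (((if (r i).re = 0 then 0 else (s i).re : ℝ)) : ℂ) := by
    refine trace_of_eigenbasis b _ _ fun i => ?_
    rw [← mulVec_mulVec, hs, mulVec_smul, hPb, smul_smul]
    congr 1
    split_ifs
    · simp
    · rw [mul_one]; exact hs1 i
  have hL : ∀ α : ℝ, (mpow (mpow σ ((1 - α) / (2 * α)) * ρ * mpow σ ((1 - α) / (2 * α))) α).trace
      = ∑ i, ((((s i).re ^ ((1 - α) / (2 * α)) * (r i).re
          * (s i).re ^ ((1 - α) / (2 * α))) ^ α : ℝ) : ℂ) := by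
    intro α
    refine trace_of_eigenbasis b _ _ fun i => ?_
    have hS := mpow_mulVec hσ.1 ((1 - α) / (2 * α)) (b i) (s i).re (by rw [hs, ← hs1])
    have hH : (mpow σ ((1 - α) / (2 * α)) * ρ * mpow σ ((1 - α) / (2 * α))).IsHermitian := by
      have h1 := mpow_isHermitian σ ((1 - α) / (2 * α))
      have h2 := Matrix.isHermitian_conjTranspose_mul_mul (mpow σ ((1 - α) / (2 * α))) hρ.1
      rwa [h1.eq] at h2
    refine mpow_mulVec hH α (b i) _ ?_
    rw [← mulVec_mulVec, ← mulVec_mulVec, hS, mulVec_smul, hr, mulVec_smul, mulVec_smul, hS,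
      smul_smul, smul_smul]
    congr 1
    push_cast
    rw [← hr1]
  simp_rw [hL]
  rw [hR]
  refine tendsto_finsetSum _ fun i _ => ?_
  exact (Complex.continuous_ofReal.tendsto _).comp (scalar_limit _ _ (hr2 i) (hs2 i))
end

section
/- Let A and B be d×d complex matrices whose real parts Re A := (A + A*)/2 and Re B := (B + B*)/2 are both positive definite. Then for every real x ≥ 0, the matrix AB + xI is invertible; equivalently, AB has no eigenvalue in the closed half-line (−∞, 0] of the real axis. -/
open Matrix
open scoped ComplexOrder

/-- The real part `Re C = (C + C*)/2` of a square complex matrix. -/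
noncomputable def rePart {n : Type*} [Fintype n] (C : Matrix n n ℂ) : Matrix n n ℂ :=
  (2 : ℂ)⁻¹ • (C + Cᴴ)

theorem rePart_pos {d : ℕ} {C : Matrix (Fin d) (Fin d) ℂ} (hC : (rePart C).PosDef)
    {v : Fin d → ℂ} (hv : v ≠ 0) : 0 < (star v ⬝ᵥ (C *ᵥ v)).re := by
  have h := hC.dotProduct_mulVec_pos hv
  have h2 : star v ⬝ᵥ (Cᴴ *ᵥ v) = star (star v ⬝ᵥ (C *ᵥ v)) := by
    rw [star_dotProduct, star_mulVec, conjTranspose_conjTranspose, ← dotProduct_mulVec]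
  rw [rePart, smul_mulVec, dotProduct_smul, add_mulVec, dotProduct_add, h2] at h
  have h3 := (Complex.lt_def.mp h).1
  simp at h3
  linarith

/-- If `Re A` and `Re B` are positive definite, then `AB + xI` is invertible for every
real x ≥ 0; equivalently, AB has no eigenvalue on the closed half-line (-∞, 0] of the
real axis. -/
theorem product_no_nonpositive_eigenvalue {d : ℕ} (A B : Matrix (Fin d) (Fin d) ℂ)
    (hA : (rePart A).PosDef) (hB : (rePart B).PosDef) :
    (∀ x : ℝ, 0 ≤ x → IsUnit (A * B + (x : ℂ) • (1 : Matrix (Fin d) (Fin d) ℂ))) ∧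
      (∀ z ∈ spectrum ℂ (A * B), z.im = 0 → 0 < z.re) := by
  have key : ∀ x : ℝ, 0 ≤ x →
      IsUnit (A * B + (x : ℂ) • (1 : Matrix (Fin d) (Fin d) ℂ)) := by
    intro x hx
    rw [← Matrix.mulVec_injective_iff_isUnit]
    refine (injective_iff_map_eq_zero
      (Matrix.mulVecLin (A * B + (x : ℂ) • (1 : Matrix (Fin d) (Fin d) ℂ)))).mpr ?_
    intro v h
    by_contra hv
    rw [Matrix.mulVecLin_apply, add_mulVec, smul_mulVec, one_mulVec, ← mulVec_mulVec] at h
    have h1 := rePart_pos hB hv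
    have hw : B *ᵥ v ≠ 0 := by
      intro e
      simp [e] at h1
    have h2 := rePart_pos hA hw
    rw [eq_neg_of_add_eq_zero_left h, dotProduct_neg, dotProduct_smul] at h2
    have h3 : star (B *ᵥ v) ⬝ᵥ v = star (star v ⬝ᵥ (B *ᵥ v)) := by
      rw [star_dotProduct]
    rw [h3] at h2
    simp at h2
    nlinarith
  refine ⟨key, fun z hz him => ?_⟩
  by_contra hre
  have hu := key (-z.re) (by linarith)
  rw [spectrum.mem_iff] at hz
  apply hz
  have hzz : z = (z.re : ℂ) := Complex.ext (by simp) (by simp [him])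
  rw [← IsUnit.neg_iff]
  convert hu using 1
  rw [Algebra.algebraMap_eq_smul_one, neg_sub, sub_eq_add_neg, ← neg_smul]
  congr 2
  rw [hzz]
  simp
end
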